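/- Suppose condition (B_p) holds for some p > 4, and conditions (Q_∞) and (M_L) hold, with the limit matrix q in (Q_∞) aperiodic. Suppose also Σ_{i∈S} (2c_i + s_i²)π(i) > 0. Then for every k ∈ S and every x ≥ 0, lim_{n→∞} P[n^{−1/2} X_n ≤ x, η_n = k] = π(k) F_{α,θ}(x), where α = 1/2 + (Σ_{i∈S} c_i π(i))/(Σ_{i∈S} s_i² π(i)) and θ = 2 Σ_{i∈S} s_i² π(i). -/

import Mathlib

open MeasureTheory Filter Topology Asymptotics
open scoped ENNReal NNReal

/-- A time-homogeneous Markov chain on a measurable state space `E`, encoded via the family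
`P z` of laws (on trajectory space) of the chain started at `z`.  The field `markov` is the
time-homogeneous Markov property: conditionally on the event `{ω n = w}` intersected with any
event `B` depending only on the first `n+1` coordinates, the shifted trajectory has law `P w`. -/
structure MChain (E : Type*) [MeasurableSpace E] where
  P : E → MeasureTheory.Measure (ℕ → E)
  isProb : ∀ z, MeasureTheory.IsProbabilityMeasure (P z)
  init : ∀ z, P z {ω | ω 0 = z} = 1
  markov : ∀ (z : E) (n : ℕ) (w : E) (A B : Set (ℕ → E)), MeasurableSet A →
    (∀ ω ω' : ℕ → E, (∀ k, k ≤ n → ω k = ω' k) → ω ∈ B → ω' ∈ B) →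
    P z (B ∩ {ω | ω n = w} ∩ {ω | (fun k => ω (n + k)) ∈ A})
      = P z (B ∩ {ω | ω n = w}) * P w A

namespace MChain

variable {E : Type*} [MeasurableSpace E]

/-- Irreducibility: every state can be reached from every state with positive probability. -/
def Irreducible (X : MChain E) : Prop := ∀ z w : E, ∃ n : ℕ, X.P z {ω | ω n = w} ≠ 0

/-- Recurrence: from every state, the chain returns to it almost surely. -/
def Recurrent (X : MChain E) : Prop := ∀ z : E, X.P z {ω | ∃ n, 1 ≤ n ∧ ω n = z} = 1

def Transient (X : MChain E) : Prop := ¬ X.Recurrent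

/-- The first return time to `z` (with junk value `0`, via `sInf ∅ = 0`, if there is no return). -/
noncomputable def returnTime (z : E) (ω : ℕ → E) : ℕ := sInf {n | 1 ≤ n ∧ ω n = z}

/-- Positive recurrence: recurrent, with finite mean return times. -/
def PositiveRecurrent (X : MChain E) : Prop :=
  X.Recurrent ∧ ∀ z : E, (∫⁻ ω, (returnTime z ω : ℝ≥0∞) ∂(X.P z)) ≠ ⊤

def NullRecurrent (X : MChain E) : Prop := X.Recurrent ∧ ¬ X.PositiveRecurrent

end MChain

section HalfStrip

variable {S : Type*} [Fintype S] [DecidableEq S] [Nonempty S]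
  [MeasurableSpace S] [MeasurableSingletonClass S]

/-- `qhat X x i j` is the probability that the `S`-coordinate moves from `i` to `j` when the
`ℕ`-coordinate is at `x`; this is `q_x(i,j) = Σ_y p(x,i,y,j)` of the paper. -/
noncomputable def qhat (X : MChain (ℕ × S)) (x : ℕ) (i j : S) : ℝ :=
  (X.P (x, i) {ω | (ω 1).2 = j}).toReal

/-- `stepMoment X k x i = μ_k(x,i) = E[(X_{n+1}-X_n)^k | X_n = x, η_n = i]`. -/
noncomputable def stepMoment (X : MChain (ℕ × S)) (k : ℕ) (x : ℕ) (i : S) : ℝ :=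
  ∫ ω, (((ω 1).1 : ℝ) - (x : ℝ)) ^ k ∂(X.P (x, i))

/-- Condition (B_p): uniformly bounded conditional `p`-th moments of the jumps of the
`ℕ`-coordinate (by the Markov property, the conditional moment given `F_n` is a function of
the current state only). -/
def CondB (X : MChain (ℕ × S)) (p : ℝ) : Prop :=
  ∃ C : ℝ≥0∞, C ≠ ⊤ ∧ ∀ (x : ℕ) (i : S),
    (∫⁻ ω, ENNReal.ofReal (|((ω 1).1 : ℝ) - (x : ℝ)| ^ p) ∂(X.P (x, i))) ≤ C

def IsStochasticMatrix (Q : S → S → ℝ) : Prop :=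
  (∀ i j, 0 ≤ Q i j) ∧ ∀ i, (∑ j, Q i j) = 1

def IsIrreducibleMatrix (Q : S → S → ℝ) : Prop :=
  ∀ i j, ∃ n : ℕ, 0 < ((Matrix.of Q) ^ n) i j

/-- Aperiodicity (for a finite irreducible stochastic matrix, eventual positivity of the
diagonal entries of the powers is equivalent to aperiodicity). -/
def IsAperiodicMatrix (Q : S → S → ℝ) : Prop :=
  ∀ i, ∃ N : ℕ, ∀ n, N ≤ n → 0 < ((Matrix.of Q) ^ n) i i

/-- `pst` is a (strictly positive) stationary distribution for `Q`. -/
def IsStationaryDist (Q : S → S → ℝ) (pst : S → ℝ) : Prop :=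
  (∀ i, 0 < pst i) ∧ (∑ i, pst i) = 1 ∧ ∀ j, (∑ i, pst i * Q i j) = pst j

/-- Condition (Q_∞): the transition matrix of the `S`-coordinate converges as `x → ∞` to an
irreducible stochastic matrix `Q`. -/
def CondQ (X : MChain (ℕ × S)) (Q : S → S → ℝ) : Prop :=
  (∀ i j, Tendsto (fun x : ℕ => qhat X x i j) atTop (nhds (Q i j))) ∧
    IsStochasticMatrix Q ∧ IsIrreducibleMatrix Q

/-- Condition (Q_∞^+): as (Q_∞), with a power-law rate of convergence. -/
def CondQplus (X : MChain (ℕ × S)) (Q : S → S → ℝ) : Prop :=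
  (∃ δ₀ : ℝ, 0 < δ₀ ∧ ∀ i j,
      (fun x : ℕ => qhat X x i j - Q i j) =O[atTop] fun x : ℕ => (x : ℝ) ^ (-δ₀)) ∧
    IsStochasticMatrix Q ∧ IsIrreducibleMatrix Q

/-- Condition (M_C): asymptotically constant drifts, `μ₁(x,i) = d_i + o(1)`. -/
def CondMC (X : MChain (ℕ × S)) (d : S → ℝ) : Prop :=
  ∀ i, Tendsto (fun x : ℕ => stepMoment X 1 x i) atTop (nhds (d i))

/-- Condition (M_L): Lamperti-type drifts, `μ₁(x,i) = c_i/x + o(1/x)`, `μ₂(x,i) = s_i² + o(1)`,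
with at least one `s_i²` nonzero. -/
def CondML (X : MChain (ℕ × S)) (c s2 : S → ℝ) : Prop :=
  (∀ i, 0 ≤ s2 i) ∧ (∃ i, s2 i ≠ 0) ∧
    (∀ i, Tendsto (fun x : ℕ => (x : ℝ) * stepMoment X 1 x i) atTop (nhds (c i))) ∧
    (∀ i, Tendsto (fun x : ℕ => stepMoment X 2 x i) atTop (nhds (s2 i)))

/-- Condition (M_L^+): Lamperti-type drifts with power-law error bounds. -/
def CondMLplus (X : MChain (ℕ × S)) (c s2 : S → ℝ) : Prop :=
  (∀ i, 0 ≤ s2 i) ∧ (∃ i, s2 i ≠ 0) ∧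
    ∃ δ₁ : ℝ, 0 < δ₁ ∧ ∀ i,
      ((fun x : ℕ => stepMoment X 1 x i - c i / (x : ℝ)) =O[atTop]
        fun x : ℕ => (x : ℝ) ^ (-1 - δ₁)) ∧
      ((fun x : ℕ => stepMoment X 2 x i - s2 i) =O[atTop] fun x : ℕ => (x : ℝ) ^ (-δ₁))

/-- Successive visit times `τ_0 < τ_1 < ⋯` of the `S`-coordinate to the distinguished state
`s0` (junk value, via `sInf ∅ = 0`, if there is no such visit). -/
noncomputable def tauSeq (s0 : S) (ω : ℕ → ℕ × S) : ℕ → ℕ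
  | 0 => sInf {n | (ω n).2 = s0}
  | m + 1 => sInf {n | tauSeq s0 ω m < n ∧ (ω n).2 = s0}

/-- `τ`, the first positive time at which the `S`-coordinate visits `s0`. -/
noncomputable def tauRet (s0 : S) (ω : ℕ → ℕ × S) : ℕ :=
  sInf {n | 1 ≤ n ∧ (ω n).2 = s0}

/-- `D_n`, the maximal displacement of the `ℕ`-coordinate during the `n`-th excursion. -/
noncomputable def Dexc (s0 : S) (n : ℕ) (ω : ℕ → ℕ × S) : ℕ :=
  Finset.sup (Finset.Icc (tauSeq s0 ω n) (tauSeq s0 ω (n + 1)))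
    fun m => Nat.dist (ω m).1 (ω (tauSeq s0 ω n)).1

/-- `N(n) = max {k : τ_k ≤ n}`. -/
noncomputable def Ncount (s0 : S) (n : ℕ) (ω : ℕ → ℕ × S) : ℕ :=
  sSup {k | tauSeq s0 ω k ≤ n}

end HalfStrip

/-- `Fdist a t` is the distribution function of the square root of a `Gamma(a,t)` random
variable: `F_{a,t}(x) = ∫_0^x 2 u^{2a-1} e^{-u²/t} / (t^a Γ(a)) du`. -/
noncomputable def Fdist (a t x : ℝ) : ℝ :=
  ∫ u in (0:ℝ)..x, 2 * u ^ (2 * a - 1) * Real.exp (-(u ^ 2) / t) / (t ^ a * Real.Gamma a)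

section Transition

open ProbabilityTheory

variable {E : Type*} [MeasurableSpace E] [Countable E] [DiscreteMeasurableSpace E]

/-- The `n`-step transition kernel of a Markov chain. -/
noncomputable def MChain.step (X : MChain E) (n : ℕ) : Kernel E E :=
  Kernel.ofFunOfCountable fun z => (X.P z).map fun ω => ω n

lemma MChain.step_eq (X : MChain E) (n : ℕ) (z : E) :
    X.step n z = (X.P z).map fun ω => ω n := rfl

lemma MChain.step_apply (X : MChain E) (n : ℕ) (z : E) (s : Set E) :
    X.step n z s = X.P z {ω | ω n ∈ s} := by
  rw [X.step_eq, Measure.map_apply (measurable_pi_apply n) (MeasurableSet.of_discrete)]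
  rfl

instance MChain.isMarkovKernel_step (X : MChain E) (n : ℕ) : IsMarkovKernel (X.step n) := by
  refine ⟨fun z => ?_⟩
  have := X.isProb z
  rw [X.step_eq]
  exact Measure.isProbabilityMeasure_map (measurable_pi_apply n).aemeasurable

lemma MChain.step_zero (X : MChain E) (z : E) : X.step 0 z = Measure.dirac z := by
  have h1 : X.step 0 z {z} = 1 := by
    rw [X.step_apply]; exact X.init z
  have hae : ∀ᵐ w ∂(X.step 0 z), w = z := by
    rw [ae_iff]
    exact (prob_compl_eq_zero_iff MeasurableSet.of_discrete).2 h1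
  ext s _
  by_cases hz : z ∈ s
  · rw [Measure.dirac_apply_of_mem hz]
    refine le_antisymm prob_le_one ?_
    rw [← h1]
    exact measure_mono (by simpa using hz)
  · rw [Measure.dirac_apply' _ MeasurableSet.of_discrete, Set.indicator_of_notMem hz]
    refine measure_mono_null (t := {w | ¬ w = z}) ?_ hae
    intro w hw h
    exact hz (h ▸ hw)

lemma MChain.step_add (X : MChain E) (m n : ℕ) : X.step (m + n) = X.step n ∘ₖ X.step m := by
  refine Kernel.ext fun z => Measure.ext fun s hs => ?_
  have := X.isProb z
  rw [Kernel.comp_apply' _ _ _ hs, lintegral_countable', X.step_apply]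
  have hmeas : ∀ w : E, MeasurableSet {ω : ℕ → E | ω m = w} := fun w =>
    measurableSet_eq_fun (measurable_pi_apply m) measurable_const
  have hsm : MeasurableSet {ω : ℕ → E | ω (m + n) ∈ s} := measurable_pi_apply (m + n) hs
  have hu : {ω : ℕ → E | ω (m + n) ∈ s}
      = ⋃ w : E, ({ω | ω m = w} ∩ {ω | ω (m + n) ∈ s}) := by
    ext ω; simp
  rw [hu, measure_iUnion]
  · refine tsum_congr fun w => ?_
    have h := X.markov z m w {ω | ω n ∈ s} Set.univ (measurable_pi_apply n hs) (fun _ _ _ _ => trivial)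
    simp only [Set.univ_inter, Set.mem_ofPred_eq] at h
    rw [h, X.step_apply, X.step_apply, mul_comm]
    rfl
  · intro a b hab
    refine Set.disjoint_left.2 fun ω h1 h2 => hab ?_
    exact h1.1.symm.trans h2.1
  · exact fun w => (hmeas w).inter hsm

lemma MChain.integral_step_add (X : MChain E) {m n : ℕ} {z : E} {f : E → ℝ}
    (hf : Integrable f (X.step (m + n) z)) :
    ∫ w, f w ∂(X.step (m + n) z) = ∫ w, ∫ v, f v ∂(X.step n w) ∂(X.step m z) := by
  rw [X.step_add] at hf ⊢
  exact Kernel.integral_comp hf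

lemma MChain.integrable_step_add (X : MChain E) {m n : ℕ} {z : E} {f : E → ℝ}
    (hf : Integrable f (X.step (m + n) z)) :
    Integrable (fun w => ∫ v, f v ∂(X.step n w)) (X.step m z) := by
  rw [X.step_add] at hf
  exact hf.integral_comp

lemma MChain.lintegral_step_add (X : MChain E) (m n : ℕ) (z : E) (f : E → ℝ≥0∞) :
    ∫⁻ w, f w ∂(X.step (m + n) z) = ∫⁻ w, ∫⁻ v, f v ∂(X.step n w) ∂(X.step m z) := by
  rw [X.step_add]
  exact Kernel.lintegral_comp _ _ _ (Measurable.of_discrete)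

lemma MChain.integral_eq_step (X : MChain E) (n : ℕ) (z : E) (f : E → ℝ) :
    ∫ ω, f (ω n) ∂(X.P z) = ∫ w, f w ∂(X.step n z) := by
  rw [X.step_eq, integral_map (measurable_pi_apply n).aemeasurable]
  exact (Measurable.of_discrete).aestronglyMeasurable

lemma MChain.lintegral_eq_step (X : MChain E) (n : ℕ) (z : E) (f : E → ℝ≥0∞) :
    ∫⁻ ω, f (ω n) ∂(X.P z) = ∫⁻ w, f w ∂(X.step n z) := by
  rw [X.step_eq, lintegral_map Measurable.of_discrete (measurable_pi_apply n)]

end Transition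

section Discrete

lemma aestronglyMeasurable_discrete {E : Type*} [MeasurableSpace E] [DiscreteMeasurableSpace E]
    (μ : Measure E) (f : E → ℝ) : AEStronglyMeasurable f μ :=
  (Measurable.of_discrete).aestronglyMeasurable

lemma integrable_of_abs_le {E : Type*} [MeasurableSpace E] [DiscreteMeasurableSpace E]
    (μ : Measure E) [IsFiniteMeasure μ] {f : E → ℝ} {M : ℝ}
    (h : ∀ w, |f w| ≤ M) : Integrable f μ :=
  Integrable.of_bound (aestronglyMeasurable_discrete μ f) M (ae_of_all _ h)

lemma abs_integral_le_of_abs_le {E : Type*} [MeasurableSpace E]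
    (μ : Measure E) [IsProbabilityMeasure μ] {f : E → ℝ} {M : ℝ}
    (h : ∀ w, |f w| ≤ M) : |∫ w, f w ∂μ| ≤ M := by
  have := norm_integral_le_of_norm_le_const (μ := μ) (f := f) (ae_of_all _ h)
  simpa using this

end Discrete

section Taylor

lemma abs_sub_le_of_hasDerivAt_uIcc {f f' : ℝ → ℝ} {a b C : ℝ}
    (h : ∀ t ∈ Set.uIcc a b, HasDerivAt f (f' t) t) (hC : ∀ t ∈ Set.uIcc a b, |f' t| ≤ C) :
    |f b - f a| ≤ C * |b - a| :=
  (convex_uIcc a b).norm_image_sub_le_of_norm_hasDerivWithin_le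
    (fun t ht => (h t ht).hasDerivWithinAt) hC Set.left_mem_uIcc Set.right_mem_uIcc

lemma abs_sub_le_abs_sub_of_mem_uIcc {a b t : ℝ} (h : t ∈ Set.uIcc a b) : |t - a| ≤ |b - a| :=
  Set.abs_sub_left_of_mem_uIcc h

/-- A second order Taylor estimate. -/
lemma abs_taylor_two {f f₁ f₂ : ℝ → ℝ} {a b C : ℝ} (hC0 : 0 ≤ C)
    (h₁ : ∀ t ∈ Set.uIcc a b, HasDerivAt f (f₁ t) t)
    (h₂ : ∀ t ∈ Set.uIcc a b, HasDerivAt f₁ (f₂ t) t) (hC : ∀ t ∈ Set.uIcc a b, |f₂ t| ≤ C) :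
    |f b - f a - f₁ a * (b - a)| ≤ C * |b - a| ^ 2 := by
  have key : ∀ t ∈ Set.uIcc a b, |f₁ t - f₁ a| ≤ C * |b - a| := by
    intro t ht
    have hsub : Set.uIcc a t ⊆ Set.uIcc a b := Set.uIcc_subset_uIcc Set.left_mem_uIcc ht
    refine (abs_sub_le_of_hasDerivAt_uIcc (fun s hs => h₂ s (hsub hs))
      (fun s hs => hC s (hsub hs))).trans ?_
    exact mul_le_mul_of_nonneg_left (abs_sub_le_abs_sub_of_mem_uIcc ht) hC0
  have := abs_sub_le_of_hasDerivAt_uIcc (f := fun t => f t - f₁ a * (t - a))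
    (f' := fun t => f₁ t - f₁ a) (a := a) (b := b) (C := C * |b - a|)
    (fun t ht => by
      exact ((h₁ t ht).sub (((hasDerivAt_id t).sub_const a).const_mul (f₁ a))).congr_deriv
        (by ring)) key
  calc |f b - f a - f₁ a * (b - a)| = |f b - f₁ a * (b - a) - (f a - f₁ a * (a - a))| := by
        congr 1; ring
    _ ≤ C * |b - a| * |b - a| := this
    _ = C * |b - a| ^ 2 := by ring

/-- A third order Taylor estimate. -/
lemma abs_taylor_three {f f₁ f₂ f₃ : ℝ → ℝ} {a b C : ℝ} (hC0 : 0 ≤ C)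
    (h₁ : ∀ t ∈ Set.uIcc a b, HasDerivAt f (f₁ t) t)
    (h₂ : ∀ t ∈ Set.uIcc a b, HasDerivAt f₁ (f₂ t) t)
    (h₃ : ∀ t ∈ Set.uIcc a b, HasDerivAt f₂ (f₃ t) t) (hC : ∀ t ∈ Set.uIcc a b, |f₃ t| ≤ C) :
    |f b - f a - f₁ a * (b - a) - f₂ a * (b - a) ^ 2 / 2| ≤ C * |b - a| ^ 3 := by
  have key : ∀ t ∈ Set.uIcc a b, |f₁ t - f₁ a - f₂ a * (t - a)| ≤ C * |b - a| ^ 2 := by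
    intro t ht
    have hsub : Set.uIcc a t ⊆ Set.uIcc a b := Set.uIcc_subset_uIcc Set.left_mem_uIcc ht
    refine (abs_taylor_two hC0 (fun s hs => h₂ s (hsub hs)) (fun s hs => h₃ s (hsub hs))
      (fun s hs => hC s (hsub hs))).trans ?_
    have := abs_sub_le_abs_sub_of_mem_uIcc ht
    gcongr
  have := abs_sub_le_of_hasDerivAt_uIcc (f := fun t => f t - f₁ a * (t - a) - f₂ a * (t - a) ^ 2 / 2)
    (f' := fun t => f₁ t - f₁ a - f₂ a * (t - a)) (a := a) (b := b) (C := C * |b - a| ^ 2)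
    (fun t ht => by
      have e1 := ((hasDerivAt_id t).sub_const a).const_mul (f₁ a)
      have e2 := ((((hasDerivAt_id t).sub_const a).pow 2).const_mul (f₂ a)).div_const 2
      exact ((h₁ t ht).sub e1 |>.sub e2).congr_deriv (by simp only [id]; ring)) key
  calc |f b - f a - f₁ a * (b - a) - f₂ a * (b - a) ^ 2 / 2|
      = |f b - f₁ a * (b - a) - f₂ a * (b - a) ^ 2 / 2
          - (f a - f₁ a * (a - a) - f₂ a * (a - a) ^ 2 / 2)| := by
        congr 1; ring
    _ ≤ C * |b - a| ^ 2 * |b - a| := this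
    _ = C * |b - a| ^ 3 := by ring

end Taylor

section Gaussian

open Real

lemma mul_exp_neg_le_one {t : ℝ} : t * exp (-t) ≤ 1 := by
  have h := add_one_le_exp t
  rw [exp_neg, ← div_eq_mul_inv, div_le_one (exp_pos t)]
  linarith

lemma sq_mul_exp_neg_le_two {t : ℝ} (ht : 0 ≤ t) : t ^ 2 * exp (-t) ≤ 2 := by
  have h := quadratic_le_exp_of_nonneg ht
  rw [exp_neg, ← div_eq_mul_inv, div_le_iff₀ (exp_pos t)]
  nlinarith

lemma hasDerivAt_exp_neg_sq (t : ℝ) :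
    HasDerivAt (fun t : ℝ => exp (-t ^ 2)) (-2 * t * exp (-t ^ 2)) t := by
  exact (((hasDerivAt_id t).pow 2).neg).exp.congr_deriv (by simp; ring)

/-- Third order Taylor estimate for the Gaussian function. -/
lemma abs_exp_neg_sq_taylor (y d : ℝ) :
    |exp (-(y + d) ^ 2) - exp (-y ^ 2) * (1 - 2 * y * d - d ^ 2 + 2 * y ^ 2 * d ^ 2)|
      ≤ 48 * |d| ^ 3 := by
  have h1 := hasDerivAt_exp_neg_sq
  have h2 : ∀ t : ℝ, HasDerivAt (fun t : ℝ => -2 * t * exp (-t ^ 2))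
      ((-2 + 4 * t ^ 2) * exp (-t ^ 2)) t := fun t => by
    exact (((hasDerivAt_id t).const_mul (-2)).mul (h1 t)).congr_deriv (by simp only [id]; ring)
  have h3 : ∀ t : ℝ, HasDerivAt (fun t : ℝ => (-2 + 4 * t ^ 2) * exp (-t ^ 2))
      ((12 * t - 8 * t ^ 3) * exp (-t ^ 2)) t := fun t => by
    exact (((((hasDerivAt_id t).pow 2).const_mul 4).const_add (-2)).mul (h1 t)).congr_deriv
      (by simp only [Pi.pow_apply, id]; ring)
  have hC : ∀ t : ℝ, |(12 * t - 8 * t ^ 3) * exp (-t ^ 2)| ≤ 48 := fun t => by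
    have e0 := exp_pos (-t ^ 2)
    have e1 : exp (-t ^ 2) ≤ 1 := exp_le_one_iff.2 (by nlinarith [sq_nonneg t])
    have e2 := mul_exp_neg_le_one (t := t ^ 2)
    have e3 := sq_mul_exp_neg_le_two (sq_nonneg t)
    have hb : |12 * t - 8 * t ^ 3| ≤ 20 + 12 * t ^ 2 + 8 * (t ^ 2) ^ 2 := by
      rw [abs_le]
      constructor <;> nlinarith [sq_nonneg (t - 1), sq_nonneg (t + 1), sq_nonneg (t ^ 2 - t),
        sq_nonneg (t ^ 2 + t), sq_nonneg t]
    rw [abs_mul, abs_of_pos e0]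
    calc _ ≤ (20 + 12 * t ^ 2 + 8 * (t ^ 2) ^ 2) * exp (-t ^ 2) := by gcongr
      _ = 20 * exp (-t ^ 2) + 12 * (t ^ 2 * exp (-t ^ 2)) + 8 * ((t ^ 2) ^ 2 * exp (-t ^ 2)) := by
        ring
      _ ≤ 48 := by linarith
  have := abs_taylor_three (a := y) (b := y + d) (C := 48) (by norm_num) (fun t _ => h1 t)
    (fun t _ => h2 t) (fun t _ => h3 t) (fun t _ => hC t)
  rw [add_sub_cancel_left] at this
  convert this using 2
  ring

lemma abs_exp_neg_sq_sub_le (y z : ℝ) : |exp (-y ^ 2) - exp (-z ^ 2)| ≤ 4 * |y - z| := by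
  refine abs_sub_le_of_hasDerivAt_uIcc (fun t _ => hasDerivAt_exp_neg_sq t) fun t _ => ?_
  have e0 := exp_pos (-t ^ 2)
  have e1 : exp (-t ^ 2) ≤ 1 := exp_le_one_iff.2 (by nlinarith [sq_nonneg t])
  have e2 := mul_exp_neg_le_one (t := t ^ 2)
  rw [abs_mul, abs_of_pos e0]
  have hb : |-2 * t| ≤ 2 + 2 * t ^ 2 := by
    rw [abs_le]
    constructor <;> nlinarith [sq_nonneg (t - 1), sq_nonneg (t + 1), sq_nonneg t]
  calc _ ≤ (2 + 2 * t ^ 2) * exp (-t ^ 2) := by gcongr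
    _ = 2 * exp (-t ^ 2) + 2 * (t ^ 2 * exp (-t ^ 2)) := by ring
    _ ≤ 4 := by linarith

lemma abs_sq_mul_exp_neg_sq_sub_le (y z : ℝ) :
    |y ^ 2 * exp (-y ^ 2) - z ^ 2 * exp (-z ^ 2)| ≤ 12 * |y - z| := by
  refine abs_sub_le_of_hasDerivAt_uIcc (f := fun t => t ^ 2 * exp (-t ^ 2))
    (f' := fun t => (2 * t - 2 * t ^ 3) * exp (-t ^ 2)) (fun t _ => ?_) fun t _ => ?_
  · exact (((hasDerivAt_id t).pow 2).mul (hasDerivAt_exp_neg_sq t)).congr_deriv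
      (by simp only [Pi.pow_apply, id]; ring)
  have e0 := exp_pos (-t ^ 2)
  have e1 : exp (-t ^ 2) ≤ 1 := exp_le_one_iff.2 (by nlinarith [sq_nonneg t])
  have e2 := mul_exp_neg_le_one (t := t ^ 2)
  have e3 := sq_mul_exp_neg_le_two (sq_nonneg t)
  have hb : |2 * t - 2 * t ^ 3| ≤ 4 + 2 * t ^ 2 + 2 * (t ^ 2) ^ 2 := by
    rw [abs_le]
    constructor <;> nlinarith [sq_nonneg (t - 1), sq_nonneg (t + 1), sq_nonneg (t ^ 2 - t),
      sq_nonneg (t ^ 2 + t), sq_nonneg t]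
  rw [abs_mul, abs_of_pos e0]
  calc _ ≤ (4 + 2 * t ^ 2 + 2 * (t ^ 2) ^ 2) * exp (-t ^ 2) := by gcongr
    _ = 4 * exp (-t ^ 2) + 2 * (t ^ 2 * exp (-t ^ 2)) + 2 * ((t ^ 2) ^ 2 * exp (-t ^ 2)) := by
      ring
    _ ≤ 12 := by linarith

/-- Second order Taylor estimate in time for the Laplace transform of a squared Bessel process. -/
lemma exists_abs_rpow_mul_exp_taylor (α : ℝ) (hα : 0 < α) : ∃ C : ℝ, 0 ≤ C ∧
    ∀ w δ : ℝ, 0 ≤ w → 0 ≤ δ → δ ≤ 1 →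
      |(1 + δ) ^ (-α) * exp (-(w / (1 + δ))) - exp (-w) * (1 - α * δ + w * δ)| ≤ C * δ ^ 2 := by
  refine ⟨16 + (2 * α ^ 2 + 4) + α, by positivity, fun w δ hw hδ hδ1 => ?_⟩
  set G : ℝ → ℝ := fun t => exp (-(w / t) - α * log t)
  set G1 : ℝ → ℝ := fun t => G t * (w / t ^ 2 - α / t)
  set G2 : ℝ → ℝ := fun t => G1 t * (w / t ^ 2 - α / t) + G t * (-2 * w / t ^ 3 + α / t ^ 2)
  have hIcc : Set.uIcc 1 (1 + δ) = Set.Icc 1 (1 + δ) := Set.uIcc_of_le (by linarith)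
  have hd1 : ∀ t ∈ Set.uIcc 1 (1 + δ), HasDerivAt G (G1 t) t := by
    intro t ht
    rw [hIcc] at ht
    have ht0 : t ≠ 0 := by linarith [ht.1]
    have a1 := (((hasDerivAt_const t w).div (hasDerivAt_id t) ht0).neg).sub
      ((hasDerivAt_log ht0).const_mul α)
    refine a1.exp.congr_deriv ?_
    simp only [G1, G, Pi.sub_apply, Pi.neg_apply, Pi.div_apply, id]
    congr 1
    field_simp
    ring
  have hd2 : ∀ t ∈ Set.uIcc 1 (1 + δ), HasDerivAt G1 (G2 t) t := by
    intro t ht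
    have hG := hd1 t ht
    rw [hIcc] at ht
    have ht0 : t ≠ 0 := by linarith [ht.1]
    have a1 := ((hasDerivAt_const t w).div ((hasDerivAt_id t).pow 2) (pow_ne_zero 2 ht0)).sub
      ((hasDerivAt_const t α).div (hasDerivAt_id t) ht0)
    refine (hG.mul a1).congr_deriv ?_
    simp only [G2, Pi.sub_apply, Pi.pow_apply, Pi.div_apply, id]
    congr 2
    field_simp
    ring
  have hC : ∀ t ∈ Set.uIcc 1 (1 + δ), |G2 t| ≤ 16 + (2 * α ^ 2 + 4) + α := by
    intro t ht
    rw [hIcc] at ht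
    obtain ⟨ht1, ht2⟩ := ht
    have ht0 : 0 < t := by linarith
    set v := w / t
    have hv : 0 ≤ v := by positivity
    have hG0 : 0 < G t := exp_pos _
    have hGle : G t ≤ exp (-v) := by
      apply exp_le_exp.2
      have : 0 ≤ α * log t := mul_nonneg hα.le (log_nonneg ht1)
      linarith
    set r := 1 / t
    have hr0 : 0 ≤ r := by positivity
    have hr1 : r ≤ 1 := by rw [div_le_one ht0]; exact ht1
    have e : G2 t = G t * ((v * r - α * r) ^ 2 + (-2 * v * r ^ 2 + α * r ^ 2)) := by
      simp only [G2, G1, v, r]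
      field_simp
    have hr2 : r ^ 2 ≤ 1 := pow_le_one₀ hr0 hr1
    have hb : |(v * r - α * r) ^ 2 + (-2 * v * r ^ 2 + α * r ^ 2)|
        ≤ 2 * v ^ 2 + 2 * α ^ 2 + 2 * v + α := by
      have : (v * r - α * r) ^ 2 + (-2 * v * r ^ 2 + α * r ^ 2)
        = r ^ 2 * ((v - α) ^ 2 - 2 * v + α) := by ring
      rw [this, abs_mul, abs_of_nonneg (sq_nonneg r)]
      have h2 : |(v - α) ^ 2 - 2 * v + α| ≤ 2 * v ^ 2 + 2 * α ^ 2 + 2 * v + α := by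
        rw [abs_le]; constructor <;> nlinarith [sq_nonneg (v + α), sq_nonneg (v - α)]
      calc _ ≤ 1 * |(v - α) ^ 2 - 2 * v + α| := by gcongr
        _ ≤ _ := by rw [one_mul]; exact h2
    have e0 := exp_pos (-v)
    have e1 : exp (-v) ≤ 1 := exp_le_one_iff.2 (by linarith)
    have e2 := mul_exp_neg_le_one (t := v)
    have e3 := sq_mul_exp_neg_le_two hv
    rw [e, abs_mul, abs_of_pos hG0]
    calc _ ≤ exp (-v) * (2 * v ^ 2 + 2 * α ^ 2 + 2 * v + α) := by gcongr
      _ = 2 * (v ^ 2 * exp (-v)) + 2 * α ^ 2 * exp (-v) + 2 * (v * exp (-v)) + α * exp (-v) := by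
        ring
      _ ≤ 2 * 2 + 2 * α ^ 2 * 1 + 2 * 1 + α * 1 := by gcongr
      _ ≤ _ := by linarith
  have := abs_taylor_two (a := 1) (b := 1 + δ) (by positivity) hd1 hd2 hC
  rw [add_sub_cancel_left, abs_of_nonneg hδ] at this
  convert this using 2
  have hpos : (0 : ℝ) < 1 + δ := by linarith
  simp only [G1, G]
  rw [Real.rpow_def_of_pos hpos, ← exp_add]
  simp
  ring_nf

/-- A concavity estimate for the power function from below. -/
lemma one_add_mul_sub_le_rpow {s ε : ℝ} (hs : -1 < s) (hε0 : 0 < ε) (hε1 : ε ≤ 1 / 2) :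
    1 + (1 - ε) * s - ε * s ^ 2 ≤ (1 + s) ^ (1 - ε) := by
  have h1s : 0 < 1 + s := by linarith
  have hb := rpow_one_add_le_one_add_mul_self hs.le hε0.le (by linarith)
  have hd : 1 / 2 ≤ 1 + ε * s := by nlinarith
  have hp : 0 < (1 + s) ^ ε := rpow_pos_of_pos h1s ε
  rw [rpow_sub h1s, rpow_one]
  calc 1 + (1 - ε) * s - ε * s ^ 2 ≤ (1 + s) / (1 + ε * s) := by
        rw [le_div_iff₀ (by linarith)]
        have h2 : ε * s ≥ -ε := by nlinarith
        nlinarith [mul_nonneg (mul_nonneg hε0.le (sq_nonneg s)) (show 0 ≤ ε * s + ε by linarith)]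
    _ ≤ (1 + s) / (1 + s) ^ ε := by gcongr

lemma one_sub_mul_le_rpow_neg {s ε : ℝ} (hs : -1 < s) (hε0 : 0 < ε) (hε1 : ε ≤ 1 / 2) :
    1 - ε * s ≤ (1 + s) ^ (-ε) := by
  have h1s : 0 < 1 + s := by linarith
  have hb := rpow_one_add_le_one_add_mul_self hs.le hε0.le (by linarith)
  have hd : 1 / 2 ≤ 1 + ε * s := by nlinarith
  have hp : 0 < (1 + s) ^ ε := rpow_pos_of_pos h1s ε
  rw [rpow_neg h1s.le, ← one_div]
  calc 1 - ε * s ≤ 1 / (1 + ε * s) := by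
        rw [le_div_iff₀ (by linarith)]
        nlinarith [sq_nonneg (ε * s)]
    _ ≤ 1 / (1 + s) ^ ε := by gcongr

end Gaussian

section HalfStripMoments

variable {S : Type*} [Fintype S] [MeasurableSpace S] [MeasurableSingletonClass S]

/-- The fourth moments of the jumps of the `ℕ`-coordinate are bounded by `C`. -/
def FourthMomentBound (X : MChain (ℕ × S)) (C : ℝ) : Prop :=
  ∀ z : ℕ × S, Integrable (fun w : ℕ × S => ((w.1 : ℝ) - z.1) ^ 4) (X.step 1 z) ∧
    ∫ w, ((w.1 : ℝ) - z.1) ^ 4 ∂(X.step 1 z) ≤ C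

lemma stepMoment_eq (X : MChain (ℕ × S)) (k x : ℕ) (i : S) :
    stepMoment X k x i = ∫ w, ((w.1 : ℝ) - x) ^ k ∂(X.step 1 (x, i)) :=
  X.integral_eq_step 1 (x, i) fun w => ((w.1 : ℝ) - x) ^ k

lemma qhat_eq (X : MChain (ℕ × S)) (x : ℕ) (i j : S) :
    qhat X x i j = (X.step 1 (x, i)).real {w | w.2 = j} := by
  rw [measureReal_def, X.step_apply]
  rfl

lemma CondB.exists_fourthMomentBound {X : MChain (ℕ × S)} {p : ℝ} (hB : CondB X p) (hp : 4 < p) :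
    ∃ C : ℝ, 0 ≤ C ∧ FourthMomentBound X C := by
  obtain ⟨C, hC, h⟩ := hB
  have key : ∀ z : ℕ × S, ∫⁻ w, ENNReal.ofReal (((w.1 : ℝ) - z.1) ^ 4) ∂(X.step 1 z) ≤ 1 + C := by
    intro z
    have h1 := h z.1 z.2
    rw [X.lintegral_eq_step 1 (z.1, z.2)
      (fun w => ENNReal.ofReal (|(w.1 : ℝ) - (z.1 : ℝ)| ^ p))] at h1
    calc ∫⁻ w, ENNReal.ofReal (((w.1 : ℝ) - z.1) ^ 4) ∂(X.step 1 z)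
        ≤ ∫⁻ w, (1 + ENNReal.ofReal (|(w.1 : ℝ) - (z.1 : ℝ)| ^ p)) ∂(X.step 1 z) := by
          refine lintegral_mono fun w => ?_
          rw [← ENNReal.ofReal_one, ← ENNReal.ofReal_add zero_le_one (by positivity)]
          refine ENNReal.ofReal_le_ofReal ?_
          set a := |(w.1 : ℝ) - (z.1 : ℝ)| with ha
          have ha0 : 0 ≤ a := abs_nonneg _
          have e : ((w.1 : ℝ) - z.1) ^ 4 = a ^ 4 := by
            rw [ha, Even.pow_abs (by decide)]
          rw [e]
          have hap : 0 ≤ a ^ p := Real.rpow_nonneg ha0 p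
          rcases le_total a 1 with h1 | h1
          · have : a ^ 4 ≤ 1 := pow_le_one₀ ha0 h1
            linarith
          · have : a ^ (4 : ℝ) ≤ a ^ p := Real.rpow_le_rpow_of_exponent_le h1 hp.le
            have e2 : a ^ (4 : ℝ) = a ^ (4 : ℕ) := by exact_mod_cast Real.rpow_natCast a 4
            rw [e2] at this
            linarith
      _ = 1 + ∫⁻ w, ENNReal.ofReal (|(w.1 : ℝ) - (z.1 : ℝ)| ^ p) ∂(X.step 1 z) := by
          rw [lintegral_add_left measurable_const]; simp
      _ ≤ 1 + C := by gcongr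
  refine ⟨(1 + C).toReal, ENNReal.toReal_nonneg, fun z => ?_⟩
  have hfin : 1 + C ≠ ⊤ := ENNReal.add_ne_top.2 ⟨ENNReal.one_ne_top, hC⟩
  have hnn : ∀ w : ℕ × S, 0 ≤ ((w.1 : ℝ) - z.1) ^ 4 := fun w => Even.pow_nonneg (by decide) _
  constructor
  · refine ⟨aestronglyMeasurable_discrete _ _, ?_⟩
    rw [hasFiniteIntegral_iff_ofReal (ae_of_all _ hnn)]
    exact (key z).trans_lt hfin.lt_top
  · rw [integral_eq_lintegral_of_nonneg_ae (ae_of_all _ hnn) (aestronglyMeasurable_discrete _ _)]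
    exact ENNReal.toReal_mono hfin (key z)

namespace FourthMomentBound

variable {X : MChain (ℕ × S)} {C : ℝ}

lemma integrable (h : FourthMomentBound X C) (z : ℕ × S) {f : ℕ × S → ℝ} (a b : ℝ)
    (hf : ∀ w : ℕ × S, |f w| ≤ a + b * ((w.1 : ℝ) - z.1) ^ 4) : Integrable f (X.step 1 z) :=
  ((integrable_const a).add ((h z).1.const_mul b)).mono' (aestronglyMeasurable_discrete _ _)
    (ae_of_all _ fun w => (Real.norm_eq_abs _).trans_le (hf w))

lemma abs_integral_le (h : FourthMomentBound X C) (z : ℕ × S) {f : ℕ × S → ℝ} (a b : ℝ) (hb : 0 ≤ b)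
    (hf : ∀ w : ℕ × S, |f w| ≤ a + b * ((w.1 : ℝ) - z.1) ^ 4) :
    |∫ w, f w ∂(X.step 1 z)| ≤ a + b * C := by
  have hi : Integrable (fun w : ℕ × S => a + b * ((w.1 : ℝ) - z.1) ^ 4) (X.step 1 z) :=
    (integrable_const a).add ((h z).1.const_mul b)
  have h1 := norm_integral_le_of_norm_le (f := f) hi (ae_of_all _ hf)
  rw [integral_add (integrable_const a) ((h z).1.const_mul b), integral_const_mul] at h1
  simp only [Real.norm_eq_abs, integral_const, probReal_univ, one_smul] at h1
  have := mul_le_mul_of_nonneg_left (h z).2 hb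
  linarith

end FourthMomentBound

lemma abs_pow_le_one_add_pow_four (t : ℝ) {k : ℕ} (hk : k ≤ 4) : |t| ^ k ≤ 1 + t ^ 4 := by
  have e : t ^ 4 = |t| ^ 4 := by rw [Even.pow_abs (by decide)]
  rw [e]
  have h0 := abs_nonneg t
  rcases le_total |t| 1 with h1 | h1
  · have := pow_le_one₀ h0 h1 (n := k)
    have : 0 ≤ |t| ^ 4 := by positivity
    linarith
  · have := pow_le_pow_right₀ h1 hk
    linarith

namespace FourthMomentBound

variable {X : MChain (ℕ × S)} {C : ℝ}

lemma integrable_abs_pow (h : FourthMomentBound X C) (z : ℕ × S) {k : ℕ} (hk : k ≤ 4) :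
    Integrable (fun w : ℕ × S => |(w.1 : ℝ) - z.1| ^ k) (X.step 1 z) :=
  h.integrable z 1 1 fun w => by
    rw [one_mul, abs_of_nonneg (by positivity)]; exact abs_pow_le_one_add_pow_four _ hk

lemma integrable_pow (h : FourthMomentBound X C) (z : ℕ × S) {k : ℕ} (hk : k ≤ 4) :
    Integrable (fun w : ℕ × S => ((w.1 : ℝ) - z.1) ^ k) (X.step 1 z) :=
  h.integrable z 1 1 fun w => by
    rw [one_mul, abs_pow]; exact abs_pow_le_one_add_pow_four _ hk

lemma integral_abs_pow_le (h : FourthMomentBound X C) (z : ℕ × S) {k : ℕ} (hk : k ≤ 4) :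
    ∫ w, |(w.1 : ℝ) - z.1| ^ k ∂(X.step 1 z) ≤ 1 + C := by
  have := h.abs_integral_le z (f := fun w : ℕ × S => |(w.1 : ℝ) - z.1| ^ k) 1 1 zero_le_one
    fun w => by
      rw [one_mul, abs_of_nonneg (by positivity)]; exact abs_pow_le_one_add_pow_four _ hk
  rw [one_mul] at this
  exact (le_abs_self _).trans this

lemma integral_sq (h : FourthMomentBound X C) (x : ℕ) (i : S) :
    ∫ w, (w.1 : ℝ) ^ 2 ∂(X.step 1 (x, i))
      = (x : ℝ) ^ 2 + 2 * (x * stepMoment X 1 x i) + stepMoment X 2 x i := by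
  have h1 := h.integrable_pow (x, i) (k := 1) (by norm_num)
  have h2 := h.integrable_pow (x, i) (k := 2) (by norm_num)
  rw [stepMoment_eq, stepMoment_eq]
  have e : ∀ w : ℕ × S, (w.1 : ℝ) ^ 2
      = ((x : ℝ) ^ 2 + 2 * x * ((w.1 : ℝ) - x) ^ 1) + ((w.1 : ℝ) - x) ^ 2 := fun w => by ring
  simp_rw [e]
  have i1 : Integrable (fun w : ℕ × S => (x : ℝ) ^ 2 + 2 * x * ((w.1 : ℝ) - x) ^ 1)
    (X.step 1 (x, i)) := (integrable_const _).add (h1.const_mul _)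
  rw [integral_add i1 h2, integral_add (integrable_const _) (h1.const_mul _), integral_const_mul]
  simp
  ring

lemma integrable_sq (h : FourthMomentBound X C) (z : ℕ × S) :
    Integrable (fun w : ℕ × S => (w.1 : ℝ) ^ 2) (X.step 1 z) := by
  refine h.integrable z (2 * (z.1 : ℝ) ^ 2 + 2) 2 fun w => ?_
  rw [abs_of_nonneg (by positivity)]
  have := abs_pow_le_one_add_pow_four ((w.1 : ℝ) - z.1) (k := 2) (by norm_num)
  rw [sq_abs] at this
  nlinarith [sq_nonneg ((w.1 : ℝ) - 2 * z.1)]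

end FourthMomentBound

lemma Filter.Tendsto.exists_abs_le {u : ℕ → ℝ} {a : ℝ} (h : Tendsto u atTop (𝓝 a)) :
    ∃ M : ℝ, 0 ≤ M ∧ ∀ n, |u n| ≤ M := by
  obtain ⟨M, hM⟩ := (Metric.isBounded_range_of_tendsto u h).exists_norm_le
  exact ⟨M, (norm_nonneg _).trans (hM _ (Set.mem_range_self 0)),
    fun n => hM _ (Set.mem_range_self n)⟩

lemma exists_abs_le_of_tendsto {S : Type*} [Fintype S] {u : ℕ → S → ℝ} {a : S → ℝ}
    (h : ∀ i, Tendsto (fun x => u x i) atTop (𝓝 (a i))) :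
    ∃ M : ℝ, 0 ≤ M ∧ ∀ x i, |u x i| ≤ M := by
  choose M hM0 hM using fun i => (h i).exists_abs_le
  refine ⟨∑ i, M i, Finset.sum_nonneg fun i _ => hM0 i, fun x i => (hM i x).trans ?_⟩
  exact Finset.single_le_sum (fun j _ => hM0 j) (Finset.mem_univ i)

/-- The second moment of the `ℕ`-coordinate grows at most linearly in time with slope `D`. -/
def LinearSecondMoment (X : MChain (ℕ × S)) (D : ℝ) : Prop :=
  ∀ (n : ℕ) (z : ℕ × S), Integrable (fun w : ℕ × S => (w.1 : ℝ) ^ 2) (X.step n z) ∧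
    ∫ w, (w.1 : ℝ) ^ 2 ∂(X.step n z) ≤ (z.1 : ℝ) ^ 2 + D * n

lemma FourthMomentBound.exists_linearSecondMoment {X : MChain (ℕ × S)} {C : ℝ}
    (h : FourthMomentBound X C) {c s2 : S → ℝ} (hML : CondML X c s2) :
    ∃ D : ℝ, 0 ≤ D ∧ LinearSecondMoment X D := by
  obtain ⟨M1, hM10, hM1⟩ := exists_abs_le_of_tendsto hML.2.2.1
  obtain ⟨M2, hM20, hM2⟩ := exists_abs_le_of_tendsto hML.2.2.2
  refine ⟨2 * M1 + M2, by positivity, fun n => ?_⟩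
  have one : ∀ z : ℕ × S, ∫ w, (w.1 : ℝ) ^ 2 ∂(X.step 1 z) ≤ (z.1 : ℝ) ^ 2 + (2 * M1 + M2) := by
    rintro ⟨x, i⟩
    rw [h.integral_sq]
    have := (abs_le.1 (hM1 x i)).2
    have := (abs_le.1 (hM2 x i)).2
    dsimp only
    linarith
  induction n with
  | zero =>
    intro z
    rw [X.step_zero]
    refine ⟨integrable_dirac (by simp), ?_⟩
    rw [integral_dirac]
    simp
  | succ n ih =>
    intro z
    obtain ⟨ih1, ih2⟩ := ih z
    have hlin : Integrable (fun w : ℕ × S => (w.1 : ℝ) ^ 2 + (2 * M1 + M2)) (X.step n z) :=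
      ih1.add (integrable_const _)
    have hmint : Integrable (fun w : ℕ × S => (w.1 : ℝ) ^ 2) (X.step (n + 1) z) := by
      refine ⟨aestronglyMeasurable_discrete _ _, ?_⟩
      rw [hasFiniteIntegral_iff_ofReal (ae_of_all _ fun w => by positivity),
        X.lintegral_step_add]
      refine lt_of_le_of_lt (lintegral_mono (g := fun w : ℕ × S =>
        ENNReal.ofReal ((w.1 : ℝ) ^ 2 + (2 * M1 + M2))) fun v => ?_) ?_
      · rw [← ofReal_integral_eq_lintegral_ofReal (h.integrable_sq v)
          (ae_of_all _ fun w => by positivity)]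
        exact ENNReal.ofReal_le_ofReal (one v)
      · exact (hasFiniteIntegral_iff_ofReal (ae_of_all _ fun w => by positivity)).1 hlin.2
    refine ⟨hmint, ?_⟩
    rw [X.integral_step_add hmint]
    calc _ ≤ ∫ w, ((w.1 : ℝ) ^ 2 + (2 * M1 + M2)) ∂(X.step n z) :=
          integral_mono (X.integrable_step_add hmint) hlin one
      _ = (∫ w, (w.1 : ℝ) ^ 2 ∂(X.step n z)) + (2 * M1 + M2) := by
          rw [integral_add ih1 (integrable_const _)]; simp
      _ ≤ _ := by push_cast; linarith

lemma LinearSecondMoment.integrable {X : MChain (ℕ × S)} {D : ℝ} (h : LinearSecondMoment X D)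
    (n : ℕ) (z : ℕ × S) {f : ℕ × S → ℝ} (a b : ℝ)
    (hf : ∀ w : ℕ × S, |f w| ≤ a + b * (w.1 : ℝ) ^ 2) : Integrable f (X.step n z) :=
  ((integrable_const a).add ((h n z).1.const_mul b)).mono' (aestronglyMeasurable_discrete _ _)
    (ae_of_all _ hf)

lemma LinearSecondMoment.integrable_abs_sub {X : MChain (ℕ × S)} {D : ℝ}
    (h : LinearSecondMoment X D) (n : ℕ) (z : ℕ × S) (x : ℝ) :
    Integrable (fun w : ℕ × S => |(w.1 : ℝ) - x|) (X.step n z) := by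
  refine h.integrable n z (1 + |x|) 1 fun w => ?_
  rw [abs_abs]
  have h1 := abs_sub (w.1 : ℝ) x
  rw [Nat.abs_cast] at h1
  nlinarith [sq_nonneg ((w.1 : ℝ) - 1)]

lemma FourthMomentBound.integral_abs_sub_le {X : MChain (ℕ × S)} {C D : ℝ}
    (h : FourthMomentBound X C) (hD : LinearSecondMoment X D) (n : ℕ) (z : ℕ × S) :
    ∫ w, |(w.1 : ℝ) - z.1| ∂(X.step n z) ≤ (1 + C) * n := by
  induction n with
  | zero =>
    rw [X.step_zero, integral_dirac]
    simp
  | succ n ih =>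
    rw [X.integral_step_add (hD.integrable_abs_sub (n + 1) z z.1)]
    calc _ ≤ ∫ w, ((1 + C) + |(w.1 : ℝ) - z.1|) ∂(X.step n z) := by
          refine integral_mono (X.integrable_step_add (hD.integrable_abs_sub (n + 1) z z.1))
            ((integrable_const _).add (hD.integrable_abs_sub n z z.1)) fun v => ?_
          calc ∫ w, |(w.1 : ℝ) - z.1| ∂(X.step 1 v)
              ≤ ∫ w, (|(w.1 : ℝ) - v.1| + |(v.1 : ℝ) - z.1|) ∂(X.step 1 v) :=
                integral_mono (hD.integrable_abs_sub 1 v z.1)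
                  ((hD.integrable_abs_sub 1 v v.1).add (integrable_const _))
                  fun w => abs_sub_le _ _ _
            _ = (∫ w, |(w.1 : ℝ) - v.1| ∂(X.step 1 v)) + |(v.1 : ℝ) - z.1| := by
                rw [integral_add (hD.integrable_abs_sub 1 v v.1) (integrable_const _)]; simp
            _ ≤ _ := by
                have := h.integral_abs_pow_le v (k := 1) (by norm_num)
                simp only [pow_one] at this
                linarith
      _ = (1 + C) + ∫ w, |(w.1 : ℝ) - z.1| ∂(X.step n z) := by
          rw [integral_add (integrable_const _) (hD.integrable_abs_sub n z z.1)]; simp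
      _ ≤ _ := by push_cast; linarith

end HalfStripMoments

section OneStep

open Real

variable {S : Type*} [Fintype S] [MeasurableSpace S] [MeasurableSingletonClass S]

lemma FourthMomentBound.abs_integral_exp_neg_sq_sub_le {X : MChain (ℕ × S)} {C : ℝ}
    (h : FourthMomentBound X C) {b : ℝ} (hb : 0 ≤ b) (x : ℕ) (i : S) :
    |∫ w, exp (-(b * w.1) ^ 2) ∂(X.step 1 (x, i)) - exp (-(b * x) ^ 2) *
        (1 - b ^ 2 * (2 * (x * stepMoment X 1 x i) + stepMoment X 2 x i)
          + 2 * (b * x) ^ 2 * b ^ 2 * stepMoment X 2 x i)| ≤ 48 * (1 + C) * b ^ 3 := by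
  have h1 := h.integrable_pow (x, i) (k := 1) (by norm_num)
  have h2 := h.integrable_pow (x, i) (k := 2) (by norm_num)
  set a := exp (-(b * x) ^ 2)
  set T : ℕ × S → ℝ := fun w => (a + (-2 * a * b ^ 2 * x) * ((w.1 : ℝ) - x) ^ 1)
    + a * (- b ^ 2 + 2 * (b * x) ^ 2 * b ^ 2) * ((w.1 : ℝ) - x) ^ 2 with hT
  have i1 : Integrable (fun w : ℕ × S => a + (-2 * a * b ^ 2 * x) * ((w.1 : ℝ) - x) ^ 1)
    (X.step 1 (x, i)) := (integrable_const _).add (h1.const_mul _)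
  have i2 : Integrable (fun w : ℕ × S =>
    a * (- b ^ 2 + 2 * (b * x) ^ 2 * b ^ 2) * ((w.1 : ℝ) - x) ^ 2) (X.step 1 (x, i)) :=
    h2.const_mul _
  have hTi : Integrable T (X.step 1 (x, i)) := i1.add i2
  have hTint : ∫ w, T w ∂(X.step 1 (x, i)) = a *
        (1 - b ^ 2 * (2 * (x * stepMoment X 1 x i) + stepMoment X 2 x i)
          + 2 * (b * x) ^ 2 * b ^ 2 * stepMoment X 2 x i) := by
    rw [hT, integral_add i1 i2, integral_add (integrable_const _) (h1.const_mul _),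
      integral_const_mul, integral_const_mul, stepMoment_eq, stepMoment_eq]
    simp
    ring
  have hei : Integrable (fun w : ℕ × S => exp (-(b * w.1) ^ 2)) (X.step 1 (x, i)) :=
    integrable_of_abs_le _ (M := 1) fun w => by
      rw [abs_of_pos (exp_pos _)]; exact exp_le_one_iff.2 (by simp; positivity)
  rw [← hTint, ← integral_sub hei hTi]
  have hb3 : Integrable (fun w : ℕ × S => 48 * b ^ 3 * |(w.1 : ℝ) - x| ^ 3) (X.step 1 (x, i)) :=
    (h.integrable_abs_pow (x, i) (k := 3) (by norm_num)).const_mul _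
  have := norm_integral_le_of_norm_le hb3 (f := fun w => exp (-(b * w.1) ^ 2) - T w)
    (ae_of_all _ fun w => by
      have ht := abs_exp_neg_sq_taylor (b * x) (b * ((w.1 : ℝ) - x))
      rw [Real.norm_eq_abs]
      calc |exp (-(b * w.1) ^ 2) - T w| = _ := ?_
        _ ≤ _ := ht
        _ = _ := by rw [abs_mul, abs_of_nonneg hb]; ring
      congr 1
      rw [hT]
      have : b * (x : ℝ) + b * ((w.1 : ℝ) - x) = b * w.1 := by ring
      rw [this]
      simp only [a]
      ring)
  refine this.trans ?_
  rw [integral_const_mul]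
  have h3 := h.integral_abs_pow_le (x, i) (k := 3) (by norm_num)
  dsimp only at h3
  have hb30 : 0 ≤ 48 * b ^ 3 := by positivity
  nlinarith [mul_le_mul_of_nonneg_left h3 hb30]

/-- One-step estimate: the heat-type flow of the Laplace transform of the squared Bessel process
is followed by the chain up to terms that average out and small errors. -/
lemma FourthMomentBound.exists_one_step {X : MChain (ℕ × S)} {C : ℝ} (h : FourthMomentBound X C)
    (hC0 : 0 ≤ C) {c s2 : S → ℝ} (hML : CondML X c s2) {α θ : ℝ} (hα : 0 < α) (hθ : 0 < θ) :
    ∃ (e : ℕ → ℝ) (K : ℝ), 0 ≤ K ∧ Tendsto e atTop (𝓝 0) ∧ (∀ x, 0 ≤ e x ∧ e x ≤ K) ∧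
      ∀ b : ℝ, 0 ≤ b → b ≤ 1 → θ * b ^ 2 ≤ 1 → ∀ (x : ℕ) (i : S),
        |∫ w, exp (-(b * w.1) ^ 2) ∂(X.step 1 (x, i))
          - (1 + θ * b ^ 2) ^ (-α) * exp (-((b * x) ^ 2 / (1 + θ * b ^ 2)))
          - b ^ 2 * (exp (-(b * x) ^ 2) * (α * θ - (2 * c i + s2 i))
              + (b * x) ^ 2 * exp (-(b * x) ^ 2) * (2 * s2 i - θ))|
          ≤ b ^ 2 * e x + K * b ^ 3 := by
  obtain ⟨G, hG0, hG⟩ := exists_abs_rpow_mul_exp_taylor α hα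
  set e : ℕ → ℝ := fun x => ∑ i, (|2 * c i + s2 i - (2 * (x * stepMoment X 1 x i)
    + stepMoment X 2 x i)| + 2 * |stepMoment X 2 x i - s2 i|) with he
  have htend : Tendsto e atTop (𝓝 0) := by
    have : Tendsto e atTop (𝓝 (∑ i : S, (|2 * c i + s2 i - (2 * c i + s2 i)|
        + 2 * |s2 i - s2 i|))) := by
      refine tendsto_finsetSum _ fun i _ => ?_
      have t1 := hML.2.2.1 i
      have t2 := hML.2.2.2 i
      exact ((tendsto_const_nhds.sub ((t1.const_mul 2).add t2)).abs).add
        (((t2.sub tendsto_const_nhds).abs).const_mul 2)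
    simpa using this
  have henn : ∀ x, 0 ≤ e x := fun x => Finset.sum_nonneg fun i _ => by positivity
  obtain ⟨M, hM0, hM⟩ := htend.exists_abs_le
  refine ⟨e, M + 48 * (1 + C) + G * θ ^ 2, by positivity, htend,
    fun x => ⟨henn x, ?_⟩, fun b hb0 hb1 hbθ x i => ?_⟩
  · have := (le_abs_self _).trans (hM x)
    have : 0 ≤ G * θ ^ 2 := by positivity
    linarith
  have ha := h.abs_integral_exp_neg_sq_sub_le hb0 x i
  have hb := hG ((b * x) ^ 2) (θ * b ^ 2) (by positivity) (by positivity) hbθ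
  set I := ∫ w, exp (-(b * w.1) ^ 2) ∂(X.step 1 (x, i))
  set R := (1 + θ * b ^ 2) ^ (-α) * exp (-((b * x) ^ 2 / (1 + θ * b ^ 2)))
  set g := exp (-(b * x) ^ 2) with hg
  set m1 := (x : ℝ) * stepMoment X 1 x i
  set m2 := stepMoment X 2 x i
  have hex : |2 * c i + s2 i - (2 * m1 + m2)| + 2 * |m2 - s2 i| ≤ e x :=
    Finset.single_le_sum (f := fun i => |2 * c i + s2 i - (2 * (x * stepMoment X 1 x i)
    + stepMoment X 2 x i)| + 2 * |stepMoment X 2 x i - s2 i|)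
      (fun j _ => by positivity) (Finset.mem_univ i)
  have hg0 : 0 < g := exp_pos _
  have hg1 : g ≤ 1 := exp_le_one_iff.2 (by simp; positivity)
  have hwg : (b * x) ^ 2 * g ≤ 1 := mul_exp_neg_le_one
  have hwg0 : 0 ≤ (b * x) ^ 2 * g := by positivity
  have hmain : |b ^ 2 * (g * (2 * c i + s2 i - (2 * m1 + m2))
      + 2 * ((b * x) ^ 2 * g) * (m2 - s2 i))| ≤ b ^ 2 * e x := by
    rw [abs_mul, abs_of_nonneg (sq_nonneg b)]
    refine mul_le_mul_of_nonneg_left ((abs_add_le _ _).trans (le_trans ?_ hex)) (sq_nonneg b)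
    rw [abs_mul, abs_mul, abs_mul, abs_of_pos hg0, abs_of_nonneg hwg0, abs_two]
    have := abs_nonneg (2 * c i + s2 i - (2 * m1 + m2))
    have := abs_nonneg (m2 - s2 i)
    nlinarith
  have hb4 : G * (θ * b ^ 2) ^ 2 ≤ G * θ ^ 2 * b ^ 3 := by
    have : b ^ 4 ≤ b ^ 3 := pow_le_pow_of_le_one hb0 hb1 (by norm_num)
    have h0 : 0 ≤ G * θ ^ 2 := by positivity
    calc G * (θ * b ^ 2) ^ 2 = G * θ ^ 2 * b ^ 4 := by ring
      _ ≤ _ := by gcongr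
  have hMb : 0 ≤ M * b ^ 3 := by positivity
  have hid : I - R - b ^ 2 * (g * (α * θ - (2 * c i + s2 i))
              + (b * x) ^ 2 * g * (2 * s2 i - θ))
      = (I - g * (1 - b ^ 2 * (2 * m1 + m2) + 2 * (b * x) ^ 2 * b ^ 2 * m2))
        - (R - g * (1 - α * (θ * b ^ 2) + (b * x) ^ 2 * (θ * b ^ 2)))
        + b ^ 2 * (g * (2 * c i + s2 i - (2 * m1 + m2)) + 2 * ((b * x) ^ 2 * g) * (m2 - s2 i)) := by
    ring
  have hgw : exp (-(b * (x : ℝ)) ^ 2) = g := rfl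
  rw [hid]
  refine (abs_add_le _ _).trans ((add_le_add (abs_sub _ _) hmain).trans ?_)
  linarith

end OneStep

section FiniteMixing

open Matrix

variable {S : Type*} [Fintype S] [DecidableEq S] {Q : S → S → ℝ} {pst : S → ℝ}

lemma IsStochasticMatrix.pow_nonneg (hQ : IsStochasticMatrix Q) (n : ℕ) (i j : S) :
    0 ≤ (Matrix.of Q ^ n) i j := by
  induction n generalizing i j with
  | zero =>
    rw [pow_zero, Matrix.one_apply]
    split_ifs <;> norm_num
  | succ n ih =>
    rw [pow_succ, Matrix.mul_apply]
    exact Finset.sum_nonneg fun k _ => mul_nonneg (ih i k) (hQ.1 k j)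

lemma IsStochasticMatrix.sum_pow (hQ : IsStochasticMatrix Q) (n : ℕ) (i : S) :
    ∑ j, (Matrix.of Q ^ n) i j = 1 := by
  induction n generalizing i with
  | zero => simp [Matrix.one_apply]
  | succ n ih =>
    simp_rw [pow_succ, Matrix.mul_apply]
    rw [Finset.sum_comm]
    simp_rw [← Finset.mul_sum, Matrix.of_apply, hQ.2, mul_one]
    exact ih i

lemma IsStationaryDist.vecMul_pow (hpst : IsStationaryDist Q pst) (n : ℕ) :
    pst ᵥ* (Matrix.of Q ^ n) = pst := by
  induction n with
  | zero => simp
  | succ n ih =>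
    rw [pow_succ, ← Matrix.vecMul_vecMul, ih]
    ext j
    exact hpst.2.2 j

lemma IsStationaryDist.dotProduct_pow_mulVec (hpst : IsStationaryDist Q pst) (n : ℕ) (ψ : S → ℝ) :
    pst ⬝ᵥ ((Matrix.of Q ^ n) *ᵥ ψ) = pst ⬝ᵥ ψ := by
  rw [Matrix.dotProduct_mulVec, hpst.vecMul_pow]

lemma exists_pow_pos (hQ : IsStochasticMatrix Q) (hirr : IsIrreducibleMatrix Q)
    (hap : IsAperiodicMatrix Q) : ∃ N : ℕ, ∀ i j, 0 < (Matrix.of Q ^ N) i j := by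
  choose n hn using hirr
  choose N hN using hap
  refine ⟨∑ i, N i + ∑ i, ∑ j, n i j, fun i j => ?_⟩
  have h1 : N i ≤ ∑ i, N i := Finset.single_le_sum (fun _ _ => Nat.zero_le _) (Finset.mem_univ i)
  have h2 : n i j ≤ ∑ i, ∑ j, n i j :=
    (Finset.single_le_sum (f := fun j => n i j) (fun _ _ => Nat.zero_le _)
      (Finset.mem_univ j)).trans
    (Finset.single_le_sum (f := fun i => ∑ j, n i j) (fun _ _ => Nat.zero_le _)
      (Finset.mem_univ i))
  obtain ⟨r, hr⟩ := Nat.exists_eq_add_of_le h2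
  have e : ∑ i, N i + ∑ i, ∑ j, n i j = (∑ i, N i + r) + n i j := by omega
  rw [e, pow_add, Matrix.mul_apply]
  refine lt_of_lt_of_le (mul_pos (hN i (∑ i, N i + r) (by omega)) (hn i j)) ?_
  exact Finset.single_le_sum (f := fun k => (Matrix.of Q ^ (∑ i, N i + r)) i k *
      (Matrix.of Q ^ n i j) k j)
    (fun k _ => mul_nonneg (hQ.pow_nonneg _ _ _) (hQ.pow_nonneg _ _ _)) (Finset.mem_univ i)

/-- Powers of an irreducible aperiodic stochastic matrix contract mean-zero functions. -/
lemma exists_abs_pow_mulVec_le [Nonempty S] (hQ : IsStochasticMatrix Q)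
    (hirr : IsIrreducibleMatrix Q) (hap : IsAperiodicMatrix Q) (hpst : IsStationaryDist Q pst)
    {ψ : S → ℝ} (hψ : ∑ i, pst i * ψ i = 0) {ε : ℝ} (hε : 0 < ε) :
    ∃ N : ℕ, ∀ i, |((Matrix.of Q ^ N) *ᵥ ψ) i| ≤ ε := by
  obtain ⟨N, hN⟩ := exists_pow_pos hQ hirr hap
  obtain ⟨ij, hij⟩ := Finite.exists_min fun ij : S × S => (Matrix.of Q ^ N) ij.1 ij.2
  set δ := (Matrix.of Q ^ N) ij.1 ij.2
  have hδ : 0 < δ := hN _ _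
  have hπ1 : ∀ j, pst j ≤ 1 := fun j => by
    rw [← hpst.2.1]
    exact Finset.single_le_sum (fun k _ => (hpst.1 k).le) (Finset.mem_univ j)
  have hmin : ∀ i j, 0 ≤ (Matrix.of Q ^ N) i j - δ * pst j := fun i j => by
    have h1 : δ ≤ (Matrix.of Q ^ N) i j := hij (i, j)
    have h2 : δ * pst j ≤ δ * 1 := mul_le_mul_of_nonneg_left (hπ1 j) hδ.le
    linarith
  have hsum : ∀ i, ∑ j, ((Matrix.of Q ^ N) i j - δ * pst j) = 1 - δ := fun i => by
    rw [Finset.sum_sub_distrib, hQ.sum_pow, ← Finset.mul_sum, hpst.2.1, mul_one]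
  have hδ1 : 0 ≤ 1 - δ := by
    rw [← hsum ij.1]
    exact Finset.sum_nonneg fun j _ => hmin _ _
  have contr : ∀ (φ : S → ℝ) (M : ℝ), pst ⬝ᵥ φ = 0 → (∀ j, |φ j| ≤ M) →
      ∀ i, |((Matrix.of Q ^ N) *ᵥ φ) i| ≤ (1 - δ) * M := by
    intro φ M h0 hM i
    have e : ((Matrix.of Q ^ N) *ᵥ φ) i = ∑ j, ((Matrix.of Q ^ N) i j - δ * pst j) * φ j := by
      simp_rw [sub_mul, mul_assoc]
      rw [Finset.sum_sub_distrib, ← Finset.mul_sum]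
      have : ∑ j, pst j * φ j = 0 := h0
      rw [this]
      simp [Matrix.mulVec, dotProduct]
    rw [e, ← hsum i, Finset.sum_mul]
    refine (Finset.abs_sum_le_sum_abs _ _).trans (Finset.sum_le_sum fun j _ => ?_)
    rw [abs_mul, abs_of_nonneg (hmin i j)]
    exact mul_le_mul_of_nonneg_left (hM j) (hmin i j)
  obtain ⟨j0, hj0⟩ := Finite.exists_max fun j => |ψ j|
  have iter : ∀ k i, |((Matrix.of Q ^ (N * k)) *ᵥ ψ) i| ≤ (1 - δ) ^ k * |ψ j0| := by
    intro k
    induction k with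
    | zero => intro i; simpa using hj0 i
    | succ k ih =>
      intro i
      rw [Nat.mul_succ, add_comm, pow_add, ← Matrix.mulVec_mulVec, pow_succ', mul_assoc]
      refine contr _ _ ?_ ih i
      rw [hpst.dotProduct_pow_mulVec]
      exact hψ
  have hlim : Tendsto (fun k => (1 - δ) ^ k * |ψ j0|) atTop (𝓝 (0 * |ψ j0|)) :=
    (tendsto_pow_atTop_nhds_zero_of_lt_one hδ1 (by linarith)).mul_const _
  rw [zero_mul] at hlim
  obtain ⟨k, hk⟩ := (hlim.eventually (gt_mem_nhds hε)).exists
  exact ⟨N * k, fun i => (iter k i).trans hk.le⟩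

end FiniteMixing

section Decoupling

open Matrix

variable {S : Type*} [Fintype S] [MeasurableSpace S] [MeasurableSingletonClass S]

lemma integral_snd (μ : Measure (ℕ × S)) [IsProbabilityMeasure μ] (φ : S → ℝ) :
    ∫ w, φ w.2 ∂μ = ∑ j, μ.real {w | w.2 = j} * φ j := by
  classical
  have e : ∀ w : ℕ × S, φ w.2 = ∑ j, Set.indicator {w : ℕ × S | w.2 = j} (fun _ => φ j) w := by
    intro w
    simp [Set.indicator_apply]
  simp_rw [e]
  rw [integral_finsetSum]
  · refine Finset.sum_congr rfl fun j _ => ?_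
    rw [integral_indicator MeasurableSet.of_discrete, setIntegral_const, smul_eq_mul]
  · exact fun j _ => (integrable_const _).indicator MeasurableSet.of_discrete

lemma FourthMomentBound.tendsto_integral_zero {X : MChain (ℕ × S)} {C : ℝ}
    (h : FourthMomentBound X C) {F : ℕ × S → ℝ} {M : ℝ} (hM : ∀ w, |F w| ≤ M)
    (hF : ∀ i, Tendsto (fun x => F (x, i)) atTop (𝓝 0)) (i : S) :
    Tendsto (fun x => ∫ w, F w ∂(X.step 1 (x, i))) atTop (𝓝 0) := by
  have hM0 : 0 ≤ M := (abs_nonneg _).trans (hM (0, i))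
  rw [Metric.tendsto_atTop]
  intro ε hε
  have hev : ∀ᶠ x in atTop, ∀ j, |F (x, j)| < ε / 2 := by
    rw [eventually_all]
    intro j
    have := (Metric.tendsto_nhds.1 (hF j)) (ε / 2) (half_pos hε)
    simpa using this
  obtain ⟨K, hK⟩ := eventually_atTop.1 hev
  have hlim : Tendsto (fun x : ℕ => M * (1 + C) / ((x : ℝ) - K)) atTop (𝓝 0) := by
    refine Tendsto.div_atTop tendsto_const_nhds ?_
    exact tendsto_atTop_add_const_right _ _ tendsto_natCast_atTop_atTop
  obtain ⟨K', hK'⟩ := eventually_atTop.1 (hlim.eventually (gt_mem_nhds (half_pos hε)))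
  refine ⟨max K' (K + 1), fun x hx => ?_⟩
  have hx1 : K' ≤ x := (le_max_left _ _).trans hx
  have hx2 : K + 1 ≤ x := (le_max_right _ _).trans hx
  have hx3 : (0 : ℝ) < (x : ℝ) - K := by
    have : (K : ℝ) + 1 ≤ x := by exact_mod_cast hx2
    linarith
  rw [Real.dist_eq, sub_zero]
  have hi := h.integrable_abs_pow (x, i) (k := 1) (by norm_num)
  simp only [pow_one] at hi
  have hmint : Integrable (fun w : ℕ × S => ε / 2 + M / ((x : ℝ) - K) * |(w.1 : ℝ) - x|)
      (X.step 1 (x, i)) := (integrable_const _).add (hi.const_mul _)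
  have hb := norm_integral_le_of_norm_le (f := F) hmint (ae_of_all _ fun w => by
    rw [Real.norm_eq_abs]
    rcases le_or_gt K w.1 with hw | hw
    · have := hK w.1 hw w.2
      have : 0 ≤ M / ((x : ℝ) - K) * |(w.1 : ℝ) - x| := by positivity
      linarith
    · have hw' : (w.1 : ℝ) ≤ K := by exact_mod_cast hw.le
      have h1 : (x : ℝ) - K ≤ |(w.1 : ℝ) - x| := by
        rw [abs_sub_comm]; exact le_trans (by linarith) (le_abs_self _)
      have h2 : M ≤ M / ((x : ℝ) - K) * |(w.1 : ℝ) - x| := by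
        rw [div_mul_eq_mul_div, le_div_iff₀ hx3]
        exact mul_le_mul_of_nonneg_left h1 hM0
      linarith [hM w])
  rw [Real.norm_eq_abs, integral_add (integrable_const _) (hi.const_mul _),
    integral_const_mul] at hb
  have h1 := h.integral_abs_pow_le (x, i) (k := 1) (by norm_num)
  simp only [pow_one] at h1
  have h2 := mul_le_mul_of_nonneg_left h1 (show 0 ≤ M / ((x : ℝ) - K) by positivity)
  have h3 := hK' x hx1
  simp only [integral_const, probReal_univ, one_smul] at hb
  rw [div_mul_eq_mul_div] at h2
  rw [div_mul_eq_mul_div] at hb h2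
  linarith

variable [DecidableEq S]

lemma FourthMomentBound.tendsto_integral_snd {X : MChain (ℕ × S)} {C : ℝ}
    (h : FourthMomentBound X C) {Q : S → S → ℝ} (hQ : CondQ X Q) (n : ℕ)
    (ψ : S → ℝ) (i : S) :
    Tendsto (fun x => ∫ w, ψ w.2 ∂(X.step n (x, i))) atTop
      (𝓝 (((Matrix.of Q ^ n) *ᵥ ψ) i)) := by
  obtain ⟨M, hM⟩ : ∃ M, ∀ j, |ψ j| ≤ M := ⟨∑ j, |ψ j|, fun j =>
    Finset.single_le_sum (f := fun j => |ψ j|) (fun _ _ => abs_nonneg _) (Finset.mem_univ j)⟩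
  induction n generalizing i with
  | zero =>
    simp only [X.step_zero, integral_dirac, pow_zero, one_mulVec]
    exact tendsto_const_nhds
  | succ n ih =>
    set ξ := (Matrix.of Q ^ n) *ᵥ ψ with hξ
    obtain ⟨M', hM'⟩ : ∃ M', ∀ j, |ξ j| ≤ M' := ⟨∑ j, |ξ j|, fun j =>
      Finset.single_le_sum (f := fun j => |ξ j|) (fun _ _ => abs_nonneg _) (Finset.mem_univ j)⟩
    have hψi : ∀ m z, Integrable (fun w : ℕ × S => ψ w.2) (X.step m z) := fun m z =>
      integrable_of_abs_le _ (M := M) fun w => hM _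
    have hξi : ∀ m z, Integrable (fun w : ℕ × S => ξ w.2) (X.step m z) := fun m z =>
      integrable_of_abs_le _ (M := M') fun w => hM' _
    set F : ℕ × S → ℝ := fun v => (∫ w, ψ w.2 ∂(X.step n v)) - ξ v.2 with hF
    have hFb : ∀ v, |F v| ≤ M + M' := fun v => by
      have h1 := abs_integral_le_of_abs_le (X.step n v) (f := fun w => ψ w.2) (M := M) fun w => hM _
      exact (abs_sub _ _).trans (add_le_add h1 (hM' _))
    have h0 : Tendsto (fun x => ∫ w, F w ∂(X.step 1 (x, i))) atTop (𝓝 0) := by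
      refine h.tendsto_integral_zero hFb (fun j => ?_) i
      have := (ih j).sub_const (ξ j)
      rwa [sub_self] at this
    have h1 : Tendsto (fun x => ∑ j, qhat X x i j * ξ j) atTop (𝓝 (∑ j, Q i j * ξ j)) :=
      tendsto_finsetSum _ fun j _ => (hQ.1 i j).mul_const _
    have h2 := h0.add h1
    rw [zero_add] at h2
    have e : ((Matrix.of Q ^ (n + 1)) *ᵥ ψ) i = ∑ j, Q i j * ξ j := by
      rw [pow_succ', ← Matrix.mulVec_mulVec]
      rfl
    rw [e]
    refine h2.congr fun x => ?_
    have e2 : ∑ j, qhat X x i j * ξ j = ∫ w, ξ w.2 ∂(X.step 1 (x, i)) := by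
      rw [integral_snd]; simp_rw [qhat_eq]
    rw [e2, ← integral_add (integrable_of_abs_le _ hFb) (hξi _ _), add_comm n 1,
      X.integral_step_add (hψi _ _)]
    simp [hF]

/-- After enough steps, the `S`-coordinate decouples from slowly varying functions of the
`ℕ`-coordinate. -/
lemma FourthMomentBound.exists_decoupling [Nonempty S] {X : MChain (ℕ × S)} {C D : ℝ}
    (h : FourthMomentBound X C) (hC : 0 ≤ C) (hD : LinearSecondMoment X D)
    {Q : S → S → ℝ} {pst : S → ℝ} (hQ : CondQ X Q)
    (hpst : IsStationaryDist Q pst) (hap : IsAperiodicMatrix Q)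
    {ψ : S → ℝ} (hψ : ∑ i, pst i * ψ i = 0) {ε : ℝ} (hε : 0 < ε) :
    ∃ (N K : ℕ) (A : ℝ), 0 ≤ A ∧ ∀ (m : ℕ) (z : ℕ × S) (Φ : ℕ → ℝ) (M L : ℝ), 0 ≤ L →
      (∀ x, |Φ x| ≤ M) → (∀ x y : ℕ, |Φ x - Φ y| ≤ L * |(x : ℝ) - y|) →
      |∫ w, Φ w.1 * ψ w.2 ∂(X.step (m + N) z)|
        ≤ M * (ε + A * (X.step m z).real {w | w.1 < K}) + A * L := by
  obtain ⟨N, hN⟩ := exists_abs_pow_mulVec_le hQ.2.1 hQ.2.2 hap hpst hψ (half_pos hε)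
  have hev : ∀ᶠ x in atTop, ∀ i, |∫ w, ψ w.2 ∂(X.step N (x, i))| ≤ ε := by
    rw [eventually_all]
    intro i
    have := (Metric.tendsto_nhds.1 (h.tendsto_integral_snd hQ N ψ i)) (ε / 2) (half_pos hε)
    filter_upwards [this] with x hx
    rw [Real.dist_eq] at hx
    have h1 := abs_sub_abs_le_abs_sub (∫ w, ψ w.2 ∂(X.step N (x, i)))
      (((Matrix.of Q ^ N) *ᵥ ψ) i)
    linarith [hN i]
  obtain ⟨K, hK⟩ := eventually_atTop.1 hev
  obtain ⟨P, hP0, hP⟩ : ∃ P, 0 ≤ P ∧ ∀ j, |ψ j| ≤ P :=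
    ⟨∑ j, |ψ j|, Finset.sum_nonneg fun _ _ => abs_nonneg _, fun j =>
    Finset.single_le_sum (f := fun j => |ψ j|) (fun _ _ => abs_nonneg _) (Finset.mem_univ j)⟩
  refine ⟨N, K, P + P * ((1 + C) * N), by positivity, fun m z Φ M L hL0 hM hL => ?_⟩
  have hM0 : 0 ≤ M := (abs_nonneg _).trans (hM 0)
  set A := P + P * ((1 + C) * N) with hA
  have hA0 : 0 ≤ A := by positivity
  have hfb : ∀ w : ℕ × S, |Φ w.1 * ψ w.2| ≤ M * P := fun w => by
    rw [abs_mul]; exact mul_le_mul (hM _) (hP _) (abs_nonneg _) hM0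
  have hfi : ∀ n z, Integrable (fun w : ℕ × S => Φ w.1 * ψ w.2) (X.step n z) := fun n z =>
    integrable_of_abs_le _ hfb
  have hψi : ∀ n z, Integrable (fun w : ℕ × S => ψ w.2) (X.step n z) := fun n z =>
    integrable_of_abs_le _ (M := P) fun w => hP _
  have inner : ∀ v : ℕ × S, |∫ w, Φ w.1 * ψ w.2 ∂(X.step N v)|
      ≤ M * ε + M * A * Set.indicator {w : ℕ × S | w.1 < K} 1 v + A * L := by
    intro v
    have e : ∫ w, Φ w.1 * ψ w.2 ∂(X.step N v)
        = ∫ w, (Φ w.1 - Φ v.1) * ψ w.2 ∂(X.step N v) + Φ v.1 * ∫ w, ψ w.2 ∂(X.step N v) := by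
      rw [← integral_const_mul, ← integral_add]
      · exact integral_congr_ae (ae_of_all _ fun w => by ring)
      · refine ((hfi N v).sub ((hψi N v).const_mul (Φ v.1))).congr (ae_of_all _ fun w => ?_)
        simp only [Pi.sub_apply]; ring
      · exact (hψi N v).const_mul _
    have h1 : |∫ w, (Φ w.1 - Φ v.1) * ψ w.2 ∂(X.step N v)| ≤ A * L := by
      have := norm_integral_le_of_norm_le
        ((hD.integrable_abs_sub N v v.1).const_mul (L * P))
        (f := fun w => (Φ w.1 - Φ v.1) * ψ w.2)
        (ae_of_all _ fun w => by
          rw [Real.norm_eq_abs, abs_mul]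
          calc _ ≤ (L * |(w.1 : ℝ) - v.1|) * P :=
                mul_le_mul (hL _ _) (hP _) (abs_nonneg _) (by positivity)
            _ = _ := by ring)
      rw [Real.norm_eq_abs, integral_const_mul] at this
      refine this.trans ?_
      have h2 := mul_le_mul_of_nonneg_left (h.integral_abs_sub_le hD N v)
        (show 0 ≤ L * P by positivity)
      have h3 : 0 ≤ P * L := by positivity
      rw [hA]; linarith
    have h2 : |Φ v.1 * ∫ w, ψ w.2 ∂(X.step N v)|
        ≤ M * ε + M * A * Set.indicator {w : ℕ × S | w.1 < K} 1 v := by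
      rw [abs_mul]
      by_cases hv : v.1 < K
      · rw [Set.indicator_of_mem (show v ∈ {w : ℕ × S | w.1 < K} from hv), Pi.one_apply, mul_one]
        have h3 := abs_integral_le_of_abs_le (X.step N v) (f := fun w => ψ w.2) (M := P)
          fun w => hP _
        have h4 : P ≤ A := by rw [hA]; linarith [show 0 ≤ P * ((1 + C) * N) by positivity]
        have := mul_le_mul (hM v.1) (h3.trans h4) (abs_nonneg _) hM0
        have : 0 ≤ M * ε := by positivity
        linarith
      · rw [Set.indicator_of_notMem (show v ∉ {w : ℕ × S | w.1 < K} from hv), mul_zero, add_zero]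
        exact mul_le_mul (hM _) (hK v.1 (not_lt.1 hv) v.2) (abs_nonneg _) hM0
    rw [e]
    refine (abs_add_le _ _).trans ?_
    linarith
  rw [X.integral_step_add (hfi _ _)]
  have hind : Integrable (fun v : ℕ × S =>
      M * A * Set.indicator {w : ℕ × S | w.1 < K} (1 : ℕ × S → ℝ) v) (X.step m z) :=
    ((integrable_const (1 : ℝ)).indicator MeasurableSet.of_discrete).const_mul _
  have i1 : Integrable (fun v : ℕ × S =>
      M * ε + M * A * Set.indicator {w : ℕ × S | w.1 < K} (1 : ℕ × S → ℝ) v) (X.step m z) :=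
    (integrable_const _).add hind
  have i2 : Integrable (fun v : ℕ × S =>
      M * ε + M * A * Set.indicator {w : ℕ × S | w.1 < K} (1 : ℕ × S → ℝ) v + A * L)
      (X.step m z) := i1.add (integrable_const _)
  have := norm_integral_le_of_norm_le (f := fun v => ∫ w, Φ w.1 * ψ w.2 ∂(X.step N v)) i2
    (ae_of_all _ inner)
  refine this.trans (le_of_eq ?_)
  rw [integral_add i1 (integrable_const _), integral_add (integrable_const _) hind,
    integral_const_mul (M * A), integral_indicator_one MeasurableSet.of_discrete]
  simp
  ring

end Decoupling

section Corrector

open Matrix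

variable {S : Type*} [Fintype S] [DecidableEq S] [Nonempty S]

/-- An approximate solution of the Poisson equation, by truncating the Neumann series. -/
lemma exists_corrector {Q : S → S → ℝ} {pst : S → ℝ} (hQ : IsStochasticMatrix Q)
    (hirr : IsIrreducibleMatrix Q) (hap : IsAperiodicMatrix Q) (hpst : IsStationaryDist Q pst)
    {f : S → ℝ} {m : ℝ} (hm : 0 < m) (hf : ∑ i, pst i * f i = m) :
    ∃ g : S → ℝ, (∀ i, 0 ≤ g i) ∧ ∀ i, m / 2 ≤ f i + ∑ j, Q i j * g j - g i := by
  set φ : S → ℝ := fun i => f i - m with hφ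
  have h0 : ∑ i, pst i * φ i = 0 := by
    simp only [hφ, mul_sub, Finset.sum_sub_distrib, hf, ← Finset.sum_mul, hpst.2.1]
    ring
  obtain ⟨N, hN⟩ := exists_abs_pow_mulVec_le hQ hirr hap hpst h0 (half_pos hm)
  set g0 : S → ℝ := ∑ l ∈ Finset.range N, (Matrix.of Q ^ l) *ᵥ φ with hg0
  have tel : (Matrix.of Q) *ᵥ g0 = g0 + ((Matrix.of Q ^ N) *ᵥ φ - φ) := by
    have h1 : (Matrix.of Q) *ᵥ g0 = ∑ l ∈ Finset.range N, (Matrix.of Q ^ (l + 1)) *ᵥ φ := by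
      rw [hg0, Matrix.mulVec_sum]
      exact Finset.sum_congr rfl fun l _ => by rw [Matrix.mulVec_mulVec, ← pow_succ']
    have h2 := Finset.sum_range_sub (fun l => (Matrix.of Q ^ l) *ᵥ φ) N
    rw [Finset.sum_sub_distrib, ← h1, ← hg0, pow_zero, Matrix.one_mulVec] at h2
    rw [← h2]; abel
  refine ⟨fun i => (∑ j, |g0 j|) + g0 i, fun i => ?_, fun i => ?_⟩
  · have := Finset.single_le_sum (f := fun j => |g0 j|) (fun _ _ => abs_nonneg _)
      (Finset.mem_univ i)
    have := neg_abs_le (g0 i)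
    dsimp only at *
    linarith
  · have h1 : ∑ j, Q i j * g0 j = g0 i + (((Matrix.of Q ^ N) *ᵥ φ) i - φ i) := congrFun tel i
    simp only [mul_add, Finset.sum_add_distrib, ← Finset.sum_mul, hQ.2 i, h1]
    have := (abs_le.1 (hN i)).1
    simp only [hφ] at *
    linarith

end Corrector

section Lyapunov

open Real

variable {S : Type*} [Fintype S] [DecidableEq S] [Nonempty S]
  [MeasurableSpace S] [MeasurableSingletonClass S]

lemma exists_rpow_one_sub_le {ε δ : ℝ} (hε : 0 < ε) (hδ : 0 < δ) :
    ∃ M : ℝ, ∀ y : ℝ, 1 ≤ y → y ^ (1 - ε) ≤ δ * y + M := by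
  have := ((tendsto_rpow_neg_atTop hε).eventually (ge_mem_nhds hδ)).and (eventually_ge_atTop 1)
  obtain ⟨M, hM, hM1⟩ := this.exists
  refine ⟨M, fun y hy => ?_⟩
  have hy0 : 0 < y := by linarith
  rcases le_total M y with h | h
  · have h1 : y ^ (1 - ε) = y ^ (-ε) * y := by
      rw [show (1 : ℝ) - ε = -ε + 1 by ring, rpow_add_one hy0.ne']
    have h2 : y ^ (-ε) ≤ M ^ (-ε) :=
      rpow_le_rpow_of_nonpos (by linarith) h (by linarith)
    rw [h1]
    have := mul_le_mul_of_nonneg_right (h2.trans hM) hy0.le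
    linarith
  · have h1 : y ^ (1 - ε) ≤ y ^ (1 : ℝ) := rpow_le_rpow_of_exponent_le hy (by linarith)
    rw [rpow_one] at h1
    have : 0 ≤ δ * y := by positivity
    linarith

/-- Pointwise lower bound for the increment of the Lyapunov function
`(1 + x²)^(1-ε) + (1 + x²)^(-ε) g`. -/
lemma rpow_lyapunov_ge {ε g G x x' : ℝ} (hε : 0 < ε) (hε2 : ε ≤ 1 / 2) (hg : 0 ≤ g) (hgG : g ≤ G) :
    (1 + x ^ 2) ^ (-ε) * (1 + x ^ 2 + (1 - ε) * (x' ^ 2 - x ^ 2) + g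
        - ε * (1 + G) * (9 + 10 * (x' - x) ^ 4))
      ≤ (1 + x' ^ 2) ^ (1 - ε) + (1 + x' ^ 2) ^ (-ε) * g := by
  set y := 1 + x ^ 2 with hy
  have hy1 : 1 ≤ y := by rw [hy]; nlinarith
  have hy0 : 0 < y := by linarith
  set R := x' ^ 2 - x ^ 2 with hR
  set s := R / y with hs
  have hys : y * (1 + s) = 1 + x' ^ 2 := by rw [hs]; field_simp; rw [hy, hR]; ring
  have hs1 : -1 < s := by
    have : 0 < y * (1 + s) := by rw [hys]; positivity
    have := pos_of_mul_pos_right this hy0.le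
    linarith
  have h1 := one_add_mul_sub_le_rpow hs1 hε hε2
  have h2 := one_sub_mul_le_rpow_neg hs1 hε hε2
  have e1 : (1 + x' ^ 2) ^ (1 - ε) = y ^ (-ε) * (y * (1 + s) ^ (1 - ε)) := by
    rw [← hys, mul_rpow hy0.le (by linarith), show (1 : ℝ) - ε = -ε + 1 by ring,
      rpow_add_one hy0.ne']
    ring
  have e2 : (1 + x' ^ 2) ^ (-ε) = y ^ (-ε) * (1 + s) ^ (-ε) := by
    rw [← hys, mul_rpow hy0.le (by linarith)]
  rw [e1, e2, mul_assoc (y ^ (-ε)), ← mul_add]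
  refine mul_le_mul_of_nonneg_left ?_ (rpow_nonneg hy0.le _)
  have h3 := mul_le_mul_of_nonneg_left h1 hy0.le
  have h4 := mul_le_mul_of_nonneg_right h2 hg
  have hRs : y * s = R := by rw [hs]; field_simp
  have h5 : y * s ^ 2 ≤ 8 + 10 * (x' - x) ^ 4 := by
    have : y * s ^ 2 = R ^ 2 / y := by rw [hs]; field_simp
    rw [this, div_le_iff₀ hy0]
    have hR' : R = 2 * x * (x' - x) + (x' - x) ^ 2 := by rw [hR]; ring
    set d := x' - x
    have a1 : R ^ 2 ≤ 8 * x ^ 2 * d ^ 2 + 2 * d ^ 4 := by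
      rw [hR']; nlinarith [sq_nonneg (2 * x * d - d ^ 2)]
    have a2 : d ^ 2 ≤ 1 + d ^ 4 := by nlinarith [sq_nonneg (d ^ 2 - 1), sq_nonneg d]
    have a3 : 8 * x ^ 2 * d ^ 2 ≤ 8 * x ^ 2 * (1 + d ^ 4) :=
      mul_le_mul_of_nonneg_left a2 (by positivity)
    rw [hy]
    nlinarith [mul_nonneg (sq_nonneg x) (show 0 ≤ d ^ 4 by positivity), sq_nonneg x,
      show 0 ≤ d ^ 4 by positivity]
  have hG : 0 ≤ G := hg.trans hgG
  have h6 : s * g ≤ G * (1 + y * s ^ 2) := by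
    have b1 : s ≤ 1 + s ^ 2 := by nlinarith [sq_nonneg (s - 1)]
    have b2 : s ^ 2 ≤ y * s ^ 2 := by nlinarith [sq_nonneg s]
    calc s * g ≤ (1 + y * s ^ 2) * g := mul_le_mul_of_nonneg_right (by linarith) hg
      _ ≤ (1 + y * s ^ 2) * G := mul_le_mul_of_nonneg_left hgG (by positivity)
      _ = _ := by ring
  have h7 : ε * (s * g + y * s ^ 2) ≤ ε * ((1 + G) * (9 + 10 * (x' - x) ^ 4)) := by
    refine mul_le_mul_of_nonneg_left ?_ hε.le
    have := mul_le_mul_of_nonneg_left h5 hG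
    nlinarith
  calc _ ≤ y * (1 + (1 - ε) * s - ε * s ^ 2) + (1 - ε * s) * g := by
        have : y * (1 + (1 - ε) * s - ε * s ^ 2) = y + (1 - ε) * R - ε * (y * s ^ 2) := by
          rw [← hRs]; ring
        rw [this]
        linarith
    _ ≤ _ := add_le_add h3 h4

/-- When the drift is outward on average, there is an unbounded function of subquadratic growth
which is subharmonic far from the origin. -/
lemma FourthMomentBound.exists_lyapunov {X : MChain (ℕ × S)} {C : ℝ}
    (h : FourthMomentBound X C) (hC : 0 ≤ C) {Q : S → S → ℝ} {pst : S → ℝ} (hQ : CondQ X Q)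
    (hpst : IsStationaryDist Q pst) (hap : IsAperiodicMatrix Q)
    {c s2 : S → ℝ} (hML : CondML X c s2) (hpos : 0 < ∑ i, (2 * c i + s2 i) * pst i) :
    ∃ V : ℕ × S → ℝ, (∀ w, 0 ≤ V w) ∧ (∀ i, Tendsto (fun x => V (x, i)) atTop atTop) ∧
      (∀ δ : ℝ, 0 < δ → ∃ M, ∀ w, V w ≤ δ * (w.1 : ℝ) ^ 2 + M) ∧
      ∃ K : ℕ, ∀ z : ℕ × S, K ≤ z.1 → V z ≤ ∫ w, V w ∂(X.step 1 z) := by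
  set m := ∑ i, (2 * c i + s2 i) * pst i with hm
  obtain ⟨g, hg0, hg⟩ := exists_corrector hQ.2.1 hQ.2.2 hap hpst (f := fun i => 2 * c i + s2 i)
    hpos (by rw [hm]; exact Finset.sum_congr rfl fun i _ => mul_comm _ _)
  obtain ⟨G, hG⟩ : ∃ G, ∀ i, g i ≤ G :=
    ⟨∑ i, g i, fun i => Finset.single_le_sum (fun j _ => hg0 j) (Finset.mem_univ i)⟩
  have hG0 : 0 ≤ G := (hg0 (Classical.arbitrary S)).trans (hG _)
  set r : ℕ → S → ℝ := fun x i => 2 * (x * stepMoment X 1 x i) + stepMoment X 2 x i with hr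
  have hrlim : ∀ i, Tendsto (fun x => r x i) atTop (𝓝 (2 * c i + s2 i)) := fun i =>
    ((hML.2.2.1 i).const_mul 2).add (hML.2.2.2 i)
  obtain ⟨B, hB0, hB⟩ := exists_abs_le_of_tendsto hrlim
  set H := (1 + G) * (9 + 10 * C) with hH
  have hH0 : 0 < H := by positivity
  obtain ⟨ε, hε, hε2, hεm⟩ : ∃ ε : ℝ, 0 < ε ∧ ε ≤ 1 / 2 ∧ ε * (B + H) ≤ m / 4 := by
    refine ⟨min (1 / 2) (m / 4 / (B + H)), lt_min (by norm_num) (by positivity), min_le_left _ _, ?_⟩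
    rw [← le_div_iff₀ (by positivity)]
    exact min_le_right _ _
  set V : ℕ × S → ℝ := fun w =>
    (1 + (w.1 : ℝ) ^ 2) ^ (1 - ε) + (1 + (w.1 : ℝ) ^ 2) ^ (-ε) * g w.2 with hV
  have hV0 : ∀ w, 0 ≤ V w := fun w => by
    have := hg0 w.2
    simp only [hV]; positivity
  have hgrow : ∀ δ : ℝ, 0 < δ → ∃ M, ∀ w, V w ≤ δ * (w.1 : ℝ) ^ 2 + M := by
    intro δ hδ
    obtain ⟨M, hM⟩ := exists_rpow_one_sub_le hε hδ
    refine ⟨δ + M + G, fun w => ?_⟩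
    have hy : (1 : ℝ) ≤ 1 + (w.1 : ℝ) ^ 2 := by nlinarith [sq_nonneg (w.1 : ℝ)]
    have h1 := hM _ hy
    have h2 : (1 + (w.1 : ℝ) ^ 2) ^ (-ε) ≤ 1 := rpow_le_one_of_one_le_of_nonpos hy (by linarith)
    have h3 := mul_le_mul h2 (hG w.2) (hg0 _) zero_le_one
    simp only [hV]
    linarith
  refine ⟨V, hV0, fun i => ?_, hgrow, ?_⟩
  · have h1 : Tendsto (fun x : ℕ => (1 + (x : ℝ) ^ 2) ^ (1 - ε)) atTop atTop := by
      refine (tendsto_rpow_atTop (by linarith : 0 < 1 - ε)).comp ?_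
      exact tendsto_atTop_add_const_left _ _
        ((tendsto_pow_atTop (by norm_num)).comp tendsto_natCast_atTop_atTop)
    refine tendsto_atTop_mono (fun x => ?_) h1
    have := hg0 i
    have : 0 ≤ (1 + (x : ℝ) ^ 2) ^ (-ε) * g i := by positivity
    simp only [hV]
    linarith
  · have hev : ∀ᶠ x in atTop, ∀ i, m / 4 ≤ r x i + (∑ j, qhat X x i j * g j) - g i := by
      rw [eventually_all]
      intro i
      have h1 : Tendsto (fun x => r x i + (∑ j, qhat X x i j * g j) - g i) atTop
          (𝓝 (2 * c i + s2 i + (∑ j, Q i j * g j) - g i)) :=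
        ((hrlim i).add (tendsto_finsetSum _ fun j _ => (hQ.1 i j).mul_const _)).sub_const _
      have h2 : m / 4 < 2 * c i + s2 i + (∑ j, Q i j * g j) - g i := by
        have := hg i
        linarith
      exact (h1.eventually (lt_mem_nhds h2)).mono fun x hx => hx.le
    obtain ⟨K, hK⟩ := eventually_atTop.1 hev
    refine ⟨K, ?_⟩
    rintro ⟨x, i⟩ hx
    have hVi : Integrable V (X.step 1 (x, i)) := by
      obtain ⟨M, hM⟩ := hgrow 1 one_pos
      refine ((h.integrable_sq (x, i)).add (integrable_const M)).mono'
        (aestronglyMeasurable_discrete _ _) (ae_of_all _ fun w => ?_)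
      rw [norm_of_nonneg (hV0 w)]
      have := hM w
      simp only [Pi.add_apply]
      linarith
    have hgi : Integrable (fun w : ℕ × S => g w.2) (X.step 1 (x, i)) :=
      integrable_of_abs_le _ (M := G) fun w => by rw [abs_of_nonneg (hg0 _)]; exact hG _
    set y : ℝ := 1 + (x : ℝ) ^ 2 with hy
    have hsq := h.integrable_sq (x, i)
    have h4 := (h (x, i)).1
    have i0 : Integrable (fun w : ℕ × S => (w.1 : ℝ) ^ 2 - (x : ℝ) ^ 2) (X.step 1 (x, i)) :=
      hsq.sub (integrable_const _)
    have h4 : Integrable (fun w : ℕ × S => ((w.1 : ℝ) - x) ^ 4) (X.step 1 (x, i)) := h4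
    have i1 : Integrable (fun w : ℕ × S => y + (1 - ε) * ((w.1 : ℝ) ^ 2 - (x : ℝ) ^ 2))
        (X.step 1 (x, i)) :=
      (integrable_const _).add (i0.const_mul _)
    have i2 : Integrable (fun w : ℕ × S => ε * (1 + G) * (9 + 10 * ((w.1 : ℝ) - x) ^ 4))
        (X.step 1 (x, i)) := ((integrable_const _).add (h4.const_mul _)).const_mul _
    have i3 : Integrable (fun w : ℕ × S => y + (1 - ε) * ((w.1 : ℝ) ^ 2 - (x : ℝ) ^ 2) + g w.2)
        (X.step 1 (x, i)) := i1.add hgi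
    have hle := integral_mono ((i3.sub i2).const_mul (y ^ (-ε))) hVi fun w =>
      rpow_lyapunov_ge (x := x) (x' := w.1) hε hε2 (hg0 w.2) (hG w.2)
    refine le_trans ?_ hle
    simp only [Pi.sub_apply]
    rw [integral_const_mul, integral_sub i3 i2, integral_add i1 hgi,
      integral_add (integrable_const _) (i0.const_mul _),
      integral_const_mul, integral_sub hsq (integrable_const _), h.integral_sq,
      integral_const_mul, integral_add (integrable_const _) (h4.const_mul _), integral_const_mul,
      integral_snd]
    simp only [← qhat_eq, integral_const, probReal_univ, one_smul]
    have e : V (x, i) = y ^ (-ε) * (y + g i) := by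
      have hy0 : y ≠ 0 := by positivity
      simp only [hV]
      rw [← hy, show (1 : ℝ) - ε = -ε + 1 by ring, rpow_add_one hy0]
      ring
    rw [e]
    refine mul_le_mul_of_nonneg_left ?_ (by positivity)
    have h5 := hK x hx i
    have h6 := (abs_le.1 (hB x i)).2
    have h7 : ε * (1 + G) * (9 + 10 * ∫ w : ℕ × S, ((w.1 : ℝ) - x) ^ 4 ∂(X.step 1 (x, i))) ≤ ε * H := by
      rw [hH, mul_assoc]
      have := (h (x, i)).2
      dsimp only at this
      gcongr
    have h8 : ε * r x i ≤ ε * B := mul_le_mul_of_nonneg_left h6 hε.le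
    simp only [hr] at h5 h8
    linarith

end Lyapunov

section Occupation

variable {S : Type*} [Fintype S] [MeasurableSpace S] [MeasurableSingletonClass S]

lemma step_real_singleton_pos {X : MChain (ℕ × S)} {n : ℕ} {v w : ℕ × S}
    (h : X.P v {ω | ω n = w} ≠ 0) : 0 < (X.step n v).real {w} := by
  rw [measureReal_def, ENNReal.toReal_pos_iff]
  refine ⟨pos_iff_ne_zero.2 ?_, measure_lt_top _ _⟩
  rw [X.step_apply]
  exact h

/-- If a nonnegative subharmonic function of subquadratic growth vanishes on an initial strip but
not identically, then the chain spends asymptotically no time in that strip. -/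
lemma tendsto_occupation_of_subharmonic {X : MChain (ℕ × S)} (hirr : X.Irreducible) {D : ℝ}
    (hD0 : 0 ≤ D) (hD : LinearSecondMoment X D) {K : ℕ} {W : ℕ × S → ℝ} (hW0 : ∀ w, 0 ≤ W w)
    (hgrow : ∀ δ : ℝ, 0 < δ → ∃ M, 0 ≤ M ∧ ∀ w, W w ≤ δ * (w.1 : ℝ) ^ 2 + M)
    (hsub : ∀ z, W z ≤ ∫ w, W w ∂(X.step 1 z)) (hzero : ∀ w : ℕ × S, w.1 < K → W w = 0)
    {w₀ : ℕ × S} (hw₀ : 0 < W w₀) (z : ℕ × S) :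
    Tendsto (fun n : ℕ => (∑ m ∈ Finset.range n, (X.step m z).real {w | w.1 < K}) / n)
      atTop (𝓝 0) := by
  have hWi : ∀ n v, Integrable W (X.step n v) := fun n v => by
    obtain ⟨M, -, hM⟩ := hgrow 1 one_pos
    refine hD.integrable n v M 1 fun w => ?_
    rw [abs_of_nonneg (hW0 w)]
    linarith [hM w]
  have hmono : ∀ v, Monotone fun n => ∫ w, W w ∂(X.step n v) := fun v =>
    monotone_nat_of_le_succ fun n => by
      rw [X.integral_step_add (hWi _ _)]
      exact integral_mono (hWi _ _) (X.integrable_step_add (hWi _ _)) hsub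
  have hpos : ∀ᶠ N in atTop, ∀ v : Fin K × S, 0 < ∫ w, W w ∂(X.step N (v.1, v.2)) := by
    rw [eventually_all]
    intro v
    obtain ⟨n, hn⟩ := hirr (v.1, v.2) w₀
    have h1 := step_real_singleton_pos hn
    have h2 : 0 < ∫ w, W w ∂(X.step n (v.1, v.2)) := by
      have h3 : ∫ w, Set.indicator {w₀} (fun _ => W w₀) w ∂(X.step n (v.1, v.2))
          ≤ ∫ w, W w ∂(X.step n (v.1, v.2)) := by
        refine integral_mono ((integrable_const _).indicator MeasurableSet.of_discrete)
          (hWi _ _) fun w => ?_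
        by_cases hw : w = w₀
        · simp [hw]
        · simpa [hw] using hW0 w
      rw [integral_indicator MeasurableSet.of_discrete, setIntegral_const, smul_eq_mul] at h3
      exact lt_of_lt_of_le (mul_pos h1 hw₀) h3
    filter_upwards [eventually_ge_atTop n] with N hN
    exact lt_of_lt_of_le h2 (hmono _ hN)
  obtain ⟨N, hN⟩ := hpos.exists
  obtain ⟨δ, hδ, hδ0⟩ : ∃ δ : ℝ, (∀ v : Fin K × S, δ ≤ ∫ w, W w ∂(X.step N (v.1, v.2))) ∧ 0 < δ := by
    have : ∀ᶠ δ : ℝ in 𝓝[>] 0, ∀ v : Fin K × S, δ ≤ ∫ w, W w ∂(X.step N (v.1, v.2)) := by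
      rw [eventually_all]
      intro v
      filter_upwards [Ioc_mem_nhdsGT (hN v)] with δ hδ using hδ.2
    exact (this.and self_mem_nhdsWithin).exists
  have hstep : ∀ v : ℕ × S, W v + δ * Set.indicator {w : ℕ × S | w.1 < K} 1 v
      ≤ ∫ w, W w ∂(X.step N v) := by
    intro v
    by_cases hv : v.1 < K
    · rw [Set.indicator_of_mem (show v ∈ {w : ℕ × S | w.1 < K} from hv), hzero v hv]
      simpa using hδ (⟨v.1, hv⟩, v.2)
    · rw [Set.indicator_of_notMem (show v ∉ {w : ℕ × S | w.1 < K} from hv), mul_zero, add_zero]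
      have := hmono v (Nat.zero_le N)
      simpa [X.step_zero] using this
  set b : ℕ → ℝ := fun n => ∫ w, W w ∂(X.step n z) with hb
  set q : ℕ → ℝ := fun m => (X.step m z).real {w | w.1 < K} with hq
  have hincr : ∀ m, b m + δ * q m ≤ b (m + N) := fun m => by
    have hind : Integrable (fun v : ℕ × S =>
        δ * Set.indicator {w : ℕ × S | w.1 < K} (1 : ℕ × S → ℝ) v) (X.step m z) :=
      ((integrable_const (1 : ℝ)).indicator MeasurableSet.of_discrete).const_mul _
    have h1 := integral_mono ((hWi m z).add hind) (X.integrable_step_add (hWi (m + N) z)) hstep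
    simp only [Pi.add_apply] at h1
    rw [← X.integral_step_add (hWi _ _), integral_add (hWi m z) hind, integral_const_mul,
      integral_indicator_one MeasurableSet.of_discrete] at h1
    exact h1
  have hsum : ∀ n, δ * ∑ m ∈ Finset.range n, q m ≤ ∑ i ∈ Finset.range N, b (n + i) := by
    intro n
    induction n with
    | zero => simpa using Finset.sum_nonneg fun i _ => integral_nonneg hW0
    | succ n ih =>
      have h1 := Finset.sum_range_succ (fun i => b (n + i)) N
      have h2 := Finset.sum_range_succ' (fun i => b (n + i)) N
      have h3 : ∑ i ∈ Finset.range N, b (n + 1 + i) = ∑ i ∈ Finset.range N, b (n + (i + 1)) :=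
        Finset.sum_congr rfl fun i _ => by rw [add_assoc, add_comm 1]
      rw [Finset.sum_range_succ, mul_add, h3]
      have := hincr n
      simp only [add_zero] at h2
      linarith
  have hq0 : ∀ n, 0 ≤ ∑ m ∈ Finset.range n, q m := fun n =>
    Finset.sum_nonneg fun m _ => measureReal_nonneg
  rw [Metric.tendsto_atTop]
  intro ε hε
  obtain ⟨δ', hδ', hδ'ε⟩ : ∃ δ' : ℝ, 0 < δ' ∧ N * (δ' * D) ≤ δ * (ε / 2) := by
    refine ⟨δ * (ε / 2) / (N * D + 1), by positivity, ?_⟩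
    rw [div_mul_eq_mul_div, ← mul_div_assoc, div_le_iff₀ (by positivity)]
    have : 0 ≤ δ * (ε / 2) := by positivity
    nlinarith
  obtain ⟨M, hM0, hM⟩ := hgrow δ' hδ'
  have hbn : ∀ n, b n ≤ δ' * ((z.1 : ℝ) ^ 2 + D * n) + M := fun n => by
    have h1 := integral_mono (hWi n z) (((hD n z).1.const_mul δ').add (integrable_const M)) hM
    simp only [Pi.add_apply] at h1
    rw [integral_add ((hD n z).1.const_mul δ') (integrable_const M), integral_const_mul] at h1
    simp only [integral_const, probReal_univ, one_smul] at h1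
    have := mul_le_mul_of_nonneg_left (hD n z).2 hδ'.le
    linarith
  set R : ℝ := N * (δ' * ((z.1 : ℝ) ^ 2 + D * N) + M) with hR
  have hBn : ∀ n : ℕ, δ * ∑ m ∈ Finset.range n, q m ≤ δ * (ε / 2) * n + R := fun n => by
    refine (hsum n).trans ?_
    have h1 : ∑ i ∈ Finset.range N, b (n + i)
        ≤ ∑ i ∈ Finset.range N, (δ' * ((z.1 : ℝ) ^ 2 + D * (n + N)) + M) := by
      refine Finset.sum_le_sum fun i hi => (hbn _).trans ?_
      have : (i : ℝ) ≤ N := by exact_mod_cast (Finset.mem_range.1 hi).le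
      push_cast
      gcongr
    rw [Finset.sum_const, Finset.card_range, nsmul_eq_mul] at h1
    have h2 := mul_le_mul_of_nonneg_right hδ'ε (Nat.cast_nonneg (α := ℝ) n)
    rw [hR]
    linarith
  have hlim : Tendsto (fun n : ℕ => R / δ / (n : ℝ)) atTop (𝓝 0) :=
    tendsto_const_div_atTop_nhds_zero_nat _
  obtain ⟨n₀, hn₀⟩ := eventually_atTop.1 (hlim.eventually (gt_mem_nhds (half_pos hε)))
  refine ⟨max n₀ 1, fun n hn => ?_⟩
  have hn1 : (0 : ℝ) < n := by exact_mod_cast (le_max_right n₀ 1).trans hn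
  have h1 := hn₀ n ((le_max_left _ _).trans hn)
  rw [Real.dist_eq, sub_zero, abs_of_nonneg (div_nonneg (hq0 n) hn1.le), div_lt_iff₀ hn1]
  rw [div_lt_iff₀ hn1, div_lt_iff₀ hδ0] at h1
  have h2 := hBn n
  have : δ * ∑ m ∈ Finset.range n, q m < δ * (ε * n) := by linarith
  exact lt_of_mul_lt_mul_left this hδ0.le

/-- When the drift is outward on average, the expected proportion of time spent near the origin
vanishes. -/
lemma FourthMomentBound.tendsto_occupation [DecidableEq S] [Nonempty S] {X : MChain (ℕ × S)}
    {C D : ℝ} (h : FourthMomentBound X C) (hC : 0 ≤ C) (hirr : X.Irreducible) (hD0 : 0 ≤ D)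
    (hD : LinearSecondMoment X D) {Q : S → S → ℝ} {pst : S → ℝ} (hQ : CondQ X Q)
    (hpst : IsStationaryDist Q pst) (hap : IsAperiodicMatrix Q)
    {c s2 : S → ℝ} (hML : CondML X c s2) (hpos : 0 < ∑ i, (2 * c i + s2 i) * pst i)
    (K : ℕ) (z : ℕ × S) :
    Tendsto (fun n : ℕ => (∑ m ∈ Finset.range n, (X.step m z).real {w | w.1 < K}) / n)
      atTop (𝓝 0) := by
  obtain ⟨V, hV0, hVlim, hgrow, K₀, hK₀⟩ := h.exists_lyapunov hC hQ hpst hap hML hpos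
  obtain ⟨A, hA0, hA⟩ : ∃ A, 0 ≤ A ∧ ∀ w : ℕ × S, w.1 < max K K₀ → V w ≤ A := by
    refine ⟨∑ v : Fin (max K K₀) × S, V (v.1, v.2), Finset.sum_nonneg fun _ _ => hV0 _,
      fun w hw => ?_⟩
    exact Finset.single_le_sum (f := fun v : Fin (max K K₀) × S => V (v.1, v.2))
      (fun _ _ => hV0 _) (Finset.mem_univ (⟨w.1, hw⟩, w.2))
  have hVi : ∀ n v, Integrable V (X.step n v) := fun n v => by
    obtain ⟨M, hM⟩ := hgrow 1 one_pos
    refine hD.integrable n v M 1 fun w => ?_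
    rw [abs_of_nonneg (hV0 w)]
    linarith [hM w]
  obtain ⟨x₀, hx₀⟩ := ((hVlim (Classical.arbitrary S)).eventually_gt_atTop A).exists
  have hWle : ∀ w, max (V w - A) 0 ≤ V w := fun w =>
    max_le (by linarith) (hV0 w)
  refine tendsto_occupation_of_subharmonic hirr hD0 hD (W := fun w => max (V w - A) 0)
    (fun w => le_max_right _ _) (fun δ hδ => ?_) (fun v => ?_) (fun w hw => ?_)
    (w₀ := (x₀, Classical.arbitrary S)) (lt_max_of_lt_left (sub_pos.2 hx₀)) z
  · obtain ⟨M, hM⟩ := hgrow δ hδ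
    exact ⟨max M 0, le_max_right _ _, fun w => (hWle w).trans
      ((hM w).trans (add_le_add le_rfl (le_max_left _ _)))⟩
  · have hWi : Integrable (fun w => max (V w - A) 0) (X.step 1 v) :=
      ((hVi 1 v).sub (integrable_const A)).sup (integrable_const 0)
    refine max_le ?_ (integral_nonneg fun w => le_max_right _ _)
    rcases lt_or_ge v.1 K₀ with hv | hv
    · have := hA v (lt_max_of_lt_right hv)
      exact le_trans (by linarith) (integral_nonneg fun w => le_max_right (V w - A) 0)
    · have h1 := integral_mono ((hVi 1 v).sub (integrable_const A)) hWi fun w => le_max_left _ _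
      simp only [Pi.sub_apply] at h1
      rw [integral_sub (hVi 1 v) (integrable_const A)] at h1
      simp only [integral_const, probReal_univ, one_smul] at h1
      exact le_trans (by linarith [hK₀ v hv]) h1
  · exact max_eq_right (by linarith [hA w (lt_max_of_lt_left hw)])

end Occupation

section Laplace

open Real

variable {S : Type*} [Fintype S] [MeasurableSpace S] [MeasurableSingletonClass S]

lemma exp_neg_sq_le_one (t : ℝ) : |exp (-t ^ 2)| ≤ 1 := by
  rw [abs_of_pos (exp_pos _)]
  exact exp_le_one_iff.2 (by nlinarith [sq_nonneg t])

lemma sq_mul_exp_neg_sq_le_one (t : ℝ) : |t ^ 2 * exp (-t ^ 2)| ≤ 1 := by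
  rw [abs_of_nonneg (by positivity)]
  exact mul_exp_neg_le_one

lemma exists_abs_le_of_fintype {S : Type*} [Fintype S] (ψ : S → ℝ) :
    ∃ P, 0 ≤ P ∧ ∀ j, |ψ j| ≤ P :=
  ⟨∑ j, |ψ j|, Finset.sum_nonneg fun _ _ => abs_nonneg _, fun j =>
    Finset.single_le_sum (f := fun j => |ψ j|) (fun _ _ => abs_nonneg _) (Finset.mem_univ j)⟩

/-- The one-step estimate integrated along the chain. -/
lemma abs_integral_step_succ_sub_le {X : MChain (ℕ × S)} {α θ b b' d d' K : ℝ} {e : ℕ → ℝ}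
    {ψ₁ ψ₂ : S → ℝ} (hα : 0 < α) (hθ : 0 < θ) (hd : 1 ≤ d) (he : ∀ x, 0 ≤ e x ∧ e x ≤ K)
    (hb : ∀ (x : ℕ) (i : S), |∫ w, exp (-(b * w.1) ^ 2) ∂(X.step 1 (x, i))
          - (1 + θ * b ^ 2) ^ (-α) * exp (-((b * x) ^ 2 / (1 + θ * b ^ 2)))
          - b ^ 2 * (exp (-(b * x) ^ 2) * ψ₁ i + (b * x) ^ 2 * exp (-(b * x) ^ 2) * ψ₂ i)|
          ≤ b ^ 2 * e x + K * b ^ 3)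
    (hb' : b' ^ 2 * (1 + θ * b ^ 2) = b ^ 2) (hd' : d' = d * (1 + θ * b ^ 2))
    (m : ℕ) (z : ℕ × S) :
    |∫ w, d ^ (-α) * exp (-(b * w.1) ^ 2) ∂(X.step (m + 1) z)
        - ∫ w, d' ^ (-α) * exp (-(b' * w.1) ^ 2) ∂(X.step m z)|
      ≤ b ^ 2 * (|∫ w, exp (-(b * w.1) ^ 2) * ψ₁ w.2 ∂(X.step m z)|
        + |∫ w, (b * w.1) ^ 2 * exp (-(b * w.1) ^ 2) * ψ₂ w.2 ∂(X.step m z)|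
        + ∫ w, e w.1 ∂(X.step m z) + K * b) := by
  have hq : 0 < 1 + θ * b ^ 2 := by positivity
  have hd0 : 0 ≤ d := by linarith
  obtain ⟨P₁, hP₁0, hP₁⟩ := exists_abs_le_of_fintype ψ₁
  obtain ⟨P₂, hP₂0, hP₂⟩ := exists_abs_le_of_fintype ψ₂
  have i1 : Integrable (fun w : ℕ × S => exp (-(b * w.1) ^ 2) * ψ₁ w.2) (X.step m z) :=
    integrable_of_abs_le _ (M := 1 * P₁) fun w => by
      rw [abs_mul]
      exact mul_le_mul (exp_neg_sq_le_one _) (hP₁ _) (abs_nonneg _) zero_le_one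
  have i2 : Integrable (fun w : ℕ × S => (b * w.1) ^ 2 * exp (-(b * w.1) ^ 2) * ψ₂ w.2)
      (X.step m z) :=
    integrable_of_abs_le _ (M := 1 * P₂) fun w => by
      rw [abs_mul]
      exact mul_le_mul (sq_mul_exp_neg_sq_le_one _) (hP₂ _) (abs_nonneg _) zero_le_one
  have ie : Integrable (fun w : ℕ × S => e w.1) (X.step m z) :=
    integrable_of_abs_le _ (M := K) fun w => by
      rw [abs_of_nonneg (he _).1]; exact (he _).2
  have iE : ∀ n v, Integrable (fun w : ℕ × S => exp (-(b * w.1) ^ 2)) (X.step n v) := fun n v =>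
    integrable_of_abs_le _ (M := 1) fun w => exp_neg_sq_le_one _
  have iE' : Integrable (fun w : ℕ × S => exp (-(b' * w.1) ^ 2)) (X.step m z) :=
    integrable_of_abs_le _ (M := 1) fun w => exp_neg_sq_le_one _
  have hexp : ∀ x : ℕ, exp (-((b * x) ^ 2 / (1 + θ * b ^ 2))) = exp (-(b' * x) ^ 2) := fun x => by
    congr 2
    rw [div_eq_iff hq.ne']
    linear_combination -((x : ℝ) ^ 2) * hb'
  set r : ℕ × S → ℝ := fun v => ∫ w, exp (-(b * w.1) ^ 2) ∂(X.step 1 v)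
          - (1 + θ * b ^ 2) ^ (-α) * exp (-(b' * v.1) ^ 2)
          - b ^ 2 * (exp (-(b * v.1) ^ 2) * ψ₁ v.2
            + (b * v.1) ^ 2 * exp (-(b * v.1) ^ 2) * ψ₂ v.2) with hr
  have hrle : ∀ v, |r v| ≤ b ^ 2 * e v.1 + K * b ^ 3 := fun v => by
    have := hb v.1 v.2
    rw [hexp] at this
    exact this
  have i12 := (i1.add i2).const_mul (b ^ 2)
  have iS := X.integrable_step_add (iE (m + 1) z)
  have iQ := iE'.const_mul ((1 + θ * b ^ 2) ^ (-α))
  have ir : Integrable r (X.step m z) := (iS.sub iQ).sub i12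
  have key : ∫ w, d ^ (-α) * exp (-(b * w.1) ^ 2) ∂(X.step (m + 1) z)
      - ∫ w, d' ^ (-α) * exp (-(b' * w.1) ^ 2) ∂(X.step m z)
      = d ^ (-α) * (b ^ 2 * (∫ w, exp (-(b * w.1) ^ 2) * ψ₁ w.2 ∂(X.step m z)
        + ∫ w, (b * w.1) ^ 2 * exp (-(b * w.1) ^ 2) * ψ₂ w.2 ∂(X.step m z))
        + ∫ v, r v ∂(X.step m z)) := by
    have e1 : ∫ v, r v ∂(X.step m z) = ∫ w, exp (-(b * w.1) ^ 2) ∂(X.step (m + 1) z)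
        - (1 + θ * b ^ 2) ^ (-α) * ∫ w, exp (-(b' * w.1) ^ 2) ∂(X.step m z)
        - b ^ 2 * (∫ w, exp (-(b * w.1) ^ 2) * ψ₁ w.2 ∂(X.step m z)
        + ∫ w, (b * w.1) ^ 2 * exp (-(b * w.1) ^ 2) * ψ₂ w.2 ∂(X.step m z)) := by
      rw [X.integral_step_add (iE _ _), ← integral_add i1 i2, ← integral_const_mul,
        ← integral_const_mul, ← integral_sub iS iQ]
      exact integral_sub (iS.sub iQ) i12
    rw [e1, integral_const_mul, integral_const_mul, hd', mul_rpow hd0 hq.le]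
    ring
  have hdα : d ^ (-α) ≤ 1 := rpow_le_one_of_one_le_of_nonpos hd (by linarith)
  have hdα0 : 0 ≤ d ^ (-α) := rpow_nonneg hd0 _
  have hrint := norm_integral_le_of_norm_le (f := r)
    ((ie.const_mul (b ^ 2)).add (integrable_const (K * b ^ 3))) (ae_of_all _ hrle)
  simp only [Pi.add_apply] at hrint
  rw [integral_add (ie.const_mul _) (integrable_const _), integral_const_mul, norm_eq_abs] at hrint
  simp only [integral_const, probReal_univ, one_smul] at hrint
  rw [key, abs_mul, abs_of_nonneg hdα0]
  refine (mul_le_of_le_one_left (abs_nonneg _) hdα).trans ((abs_add_le _ _).trans ?_)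
  rw [abs_mul, abs_of_nonneg (sq_nonneg b)]
  have := mul_le_mul_of_nonneg_left (abs_add_le
    (∫ w, exp (-(b * w.1) ^ 2) * ψ₁ w.2 ∂(X.step m z))
    (∫ w, (b * w.1) ^ 2 * exp (-(b * w.1) ^ 2) * ψ₂ w.2 ∂(X.step m z))) (sq_nonneg b)
  linarith

/-- Mean-zero functions of the `S`-coordinate average out along the chain, uniformly over slowly
varying weights depending on the `ℕ`-coordinate. -/
lemma FourthMomentBound.exists_averaging [DecidableEq S] [Nonempty S] {X : MChain (ℕ × S)}
    {C D : ℝ} (h : FourthMomentBound X C) (hC : 0 ≤ C) (hD : LinearSecondMoment X D)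
    {Q : S → S → ℝ} {pst : S → ℝ} (hQ : CondQ X Q) (hpst : IsStationaryDist Q pst)
    (hap : IsAperiodicMatrix Q) (z : ℕ × S)
    (hocc : ∀ K : ℕ, Tendsto (fun n : ℕ =>
      (∑ m ∈ Finset.range n, (X.step m z).real {w | w.1 < K}) / n) atTop (𝓝 0))
    {ψ : S → ℝ} (hψ : ∑ i, pst i * ψ i = 0) {ε : ℝ} (hε : 0 < ε) :
    ∃ (ρ : ℕ → ℝ) (A : ℝ), 0 ≤ A ∧
      Tendsto (fun n : ℕ => (∑ m ∈ Finset.range n, ρ m) / n) atTop (𝓝 0) ∧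
      ∀ (m : ℕ) (Φ : ℕ → ℝ) (L : ℝ), 0 ≤ L → (∀ x, |Φ x| ≤ 1) →
        (∀ x y : ℕ, |Φ x - Φ y| ≤ L * |(x : ℝ) - y|) →
        |∫ w, Φ w.1 * ψ w.2 ∂(X.step m z)| ≤ ε + ρ m + A * L := by
  obtain ⟨N, K, A, hA, hdec⟩ := h.exists_decoupling hC hD hQ hpst hap hψ hε
  obtain ⟨P, hP0, hP⟩ := exists_abs_le_of_fintype ψ
  set q : ℕ → ℝ := fun m => (X.step m z).real {w | w.1 < K} with hq
  have hq0 : ∀ m, 0 ≤ q m := fun m => measureReal_nonneg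
  set ρ : ℕ → ℝ := fun m => if m < N then P else A * q (m - N) with hρ
  have hρ0 : ∀ m, 0 ≤ ρ m := fun m => by
    simp only [hρ]; split_ifs
    · exact hP0
    · exact mul_nonneg hA (hq0 _)
  refine ⟨ρ, A, hA, ?_, fun m Φ L hL hΦ hΦL => ?_⟩
  · have hle : ∀ n, ∑ m ∈ Finset.range n, ρ m ≤ N * P + A * ∑ m ∈ Finset.range n, q m := by
      intro n
      calc _ ≤ ∑ m ∈ Finset.range (N + n), ρ m :=
            Finset.sum_le_sum_of_subset_of_nonneg
              (Finset.range_mono (Nat.le_add_left _ _)) fun m _ _ => hρ0 m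
        _ = _ := by
          rw [Finset.sum_range_add, Finset.mul_sum]
          congr 1
          · rw [Finset.sum_congr rfl fun m hm => if_pos (Finset.mem_range.1 hm)]
            simp
          · exact Finset.sum_congr rfl fun m _ => by simp [hρ]
    have hlim : Tendsto (fun n : ℕ => N * P / (n : ℝ) + A * ((∑ m ∈ Finset.range n, q m) / n))
        atTop (𝓝 0) := by
      simpa using (tendsto_const_div_atTop_nhds_zero_nat (N * P)).add ((hocc K).const_mul A)
    refine squeeze_zero (fun n => div_nonneg (Finset.sum_nonneg fun m _ => hρ0 m)
      (Nat.cast_nonneg n)) (fun n => ?_) hlim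
    rw [← mul_div_assoc, ← add_div]
    exact div_le_div_of_nonneg_right (hle n) (Nat.cast_nonneg n)
  · rcases lt_or_ge m N with hm | hm
    · have h1 : |∫ w, Φ w.1 * ψ w.2 ∂(X.step m z)| ≤ 1 * P :=
        abs_integral_le_of_abs_le _ fun w => by
          rw [abs_mul]; exact mul_le_mul (hΦ _) (hP _) (abs_nonneg _) zero_le_one
      have h2 : ρ m = P := if_pos hm
      have : 0 ≤ A * L := by positivity
      rw [h2]
      linarith
    · have h1 := hdec (m - N) z Φ 1 L hL hΦ hΦL
      rw [Nat.sub_add_cancel hm] at h1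
      have h2 : ρ m = A * q (m - N) := if_neg hm.not_gt
      rw [h2]
      linarith

/-- Convergence of the Laplace transform of the squared `ℕ`-coordinate. -/
lemma FourthMomentBound.tendsto_laplace [DecidableEq S] [Nonempty S] {X : MChain (ℕ × S)}
    {C D : ℝ} (h : FourthMomentBound X C) (hC : 0 ≤ C) (hirr : X.Irreducible) (hD0 : 0 ≤ D)
    (hD : LinearSecondMoment X D) {Q : S → S → ℝ} {pst : S → ℝ} (hQ : CondQ X Q)
    (hpst : IsStationaryDist Q pst) (hap : IsAperiodicMatrix Q)
    {c s2 : S → ℝ} (hML : CondML X c s2) {α θ : ℝ} (hα : 0 < α) (hθ : 0 < θ)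
    (hαθ : ∑ i, (2 * c i + s2 i) * pst i = α * θ) (hθs : 2 * ∑ i, s2 i * pst i = θ)
    (z : ℕ × S) {l : ℝ} (hl : 0 < l) :
    Tendsto (fun n : ℕ => ∫ w, exp (-(√(l / n) * w.1) ^ 2) ∂(X.step n z)) atTop
      (𝓝 ((1 + θ * l) ^ (-α))) := by
  have hocc := fun K => h.tendsto_occupation hC hirr hD0 hD hQ hpst hap hML
    (by rw [hαθ]; positivity) K z
  obtain ⟨e, K, hK0, helim, he, hone⟩ := h.exists_one_step hC hML hα hθ
  have hψ₁ : ∑ i, pst i * (α * θ - (2 * c i + s2 i)) = 0 := by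
    simp only [mul_sub, Finset.sum_sub_distrib, ← Finset.sum_mul, hpst.2.1]
    rw [one_mul, ← hαθ, sub_eq_zero]
    exact Finset.sum_congr rfl fun i _ => mul_comm _ _
  have hψ₂ : ∑ i, pst i * (2 * s2 i - θ) = 0 := by
    simp only [mul_sub, Finset.sum_sub_distrib, ← Finset.sum_mul, hpst.2.1]
    rw [one_mul, ← hθs, sub_eq_zero, Finset.mul_sum]
    exact Finset.sum_congr rfl fun i _ => by ring
  set d : ℕ → ℕ → ℝ := fun n k => 1 + θ * l * k / n with hd
  set b : ℕ → ℕ → ℝ := fun n k => √(l / (n * d n k)) with hb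
  have hd1 : ∀ n k, 1 ≤ d n k := fun n k => by
    have : 0 ≤ θ * l * k / n := by positivity
    simp only [hd]; linarith
  have hb2 : ∀ n k, b n k ^ 2 = l / (n * d n k) := fun n k =>
    sq_sqrt (div_nonneg hl.le (mul_nonneg (Nat.cast_nonneg n) (zero_le_one.trans (hd1 n k))))
  have hb2le : ∀ n : ℕ, 0 < n → ∀ k, b n k ^ 2 ≤ l / n := fun n hn k => by
    rw [hb2]
    have hn' : (0 : ℝ) < n := by exact_mod_cast hn
    exact div_le_div_of_nonneg_left hl.le hn' (le_mul_of_one_le_right hn'.le (hd1 n k))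
  set a : ℕ → ℕ → ℝ := fun n m =>
    ∫ w, d n (n - m) ^ (-α) * exp (-(b n (n - m) * w.1) ^ 2) ∂(X.step m z) with ha
  have hmain : Tendsto (fun n => a n n - a n 0) atTop (𝓝 0) := by
    rw [Metric.tendsto_atTop]
    intro ε₀ hε₀
    obtain ⟨ε, hε, hεε⟩ : ∃ ε : ℝ, 0 < ε ∧ l * (3 * ε) < ε₀ :=
      ⟨ε₀ / (6 * l), by positivity, by field_simp; norm_num⟩
    obtain ⟨ρ₁, A₁, hA₁, hρ₁, h₁⟩ := h.exists_averaging hC hD hQ hpst hap z hocc hψ₁ hε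
    obtain ⟨ρ₂, A₂, hA₂, hρ₂, h₂⟩ := h.exists_averaging hC hD hQ hpst hap z hocc hψ₂ hε
    obtain ⟨K', hK'⟩ := eventually_atTop.1 (helim.eventually (gt_mem_nhds hε))
    set q : ℕ → ℝ := fun m => (X.step m z).real {w | w.1 < K'} with hq
    have heint : ∀ m, ∫ w, e w.1 ∂(X.step m z) ≤ ε + K * q m := fun m => by
      have hind : Integrable (fun v : ℕ × S =>
          K * Set.indicator {w : ℕ × S | w.1 < K'} (1 : ℕ × S → ℝ) v) (X.step m z) :=
        ((integrable_const (1 : ℝ)).indicator MeasurableSet.of_discrete).const_mul _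
      have hei : Integrable (fun w : ℕ × S => e w.1) (X.step m z) :=
        integrable_of_abs_le _ (M := K) fun w => by
          rw [abs_of_nonneg (he _).1]; exact (he _).2
      have h3 := integral_mono hei ((integrable_const ε).add hind) fun w => by
        simp only [Pi.add_apply]
        by_cases hw : w.1 < K'
        · rw [Set.indicator_of_mem (show w ∈ {w : ℕ × S | w.1 < K'} from hw), Pi.one_apply]
          linarith [(he w.1).2]
        · rw [Set.indicator_of_notMem (show w ∉ {w : ℕ × S | w.1 < K'} from hw)]
          linarith [hK' w.1 (not_lt.1 hw)]
      simp only [Pi.add_apply] at h3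
      rw [integral_add (integrable_const _) hind, integral_const_mul,
        integral_indicator_one MeasurableSet.of_discrete] at h3
      simpa using h3
    set R : ℕ → ℝ := fun n => (∑ m ∈ Finset.range n, ρ₁ m) / n + (∑ m ∈ Finset.range n, ρ₂ m) / n
      + K * ((∑ m ∈ Finset.range n, q m) / n) + (4 * A₁ + 12 * A₂ + K) * √(l / n) with hR
    have hln : Tendsto (fun n : ℕ => l / (n : ℝ)) atTop (𝓝 0) :=
      tendsto_const_div_atTop_nhds_zero_nat l
    have hsq : Tendsto (fun n : ℕ => √(l / (n : ℝ))) atTop (𝓝 0) := by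
      have := (continuous_sqrt.tendsto 0).comp hln
      rwa [sqrt_zero] at this
    have hRlim : Tendsto (fun n => l * (3 * ε + R n)) atTop (𝓝 (l * (3 * ε))) := by
      have := (((hρ₁.add hρ₂).add ((hocc K').const_mul K)).add
        (hsq.const_mul (4 * A₁ + 12 * A₂ + K)))
      simp only [mul_zero, add_zero] at this
      have := (this.const_add (3 * ε)).const_mul l
      rwa [add_zero] at this
    have hev := (hRlim.eventually (gt_mem_nhds hεε)).and
      ((hln.eventually (ge_mem_nhds one_pos)).and
        (((hln.const_mul θ).eventually (ge_mem_nhds (by simp : θ * 0 < 1))).and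
          (eventually_gt_atTop 0)))
    obtain ⟨n₀, hn₀⟩ := eventually_atTop.1 hev
    refine ⟨n₀, fun n hn => ?_⟩
    obtain ⟨hn1, hn2, hn3, hn4⟩ := hn₀ n hn
    have hn' : (0 : ℝ) < n := by exact_mod_cast hn4
    rw [Real.dist_eq, sub_zero]
    refine lt_of_le_of_lt ?_ hn1
    have hincr : ∀ m ∈ Finset.range n, |a n (m + 1) - a n m| ≤ l / n * (3 * ε
        + (ρ₁ m + ρ₂ m + K * q m + (4 * A₁ + 12 * A₂ + K) * √(l / n))) := by
      intro m hm
      have hmn := Finset.mem_range.1 hm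
      obtain ⟨k, hk⟩ : ∃ k, n = m + 1 + k := ⟨n - (m + 1), by omega⟩
      have hk1 : n - (m + 1) = k := by omega
      have hk2 : n - m = k + 1 := by omega
      simp only [ha]
      rw [hk1, hk2]
      have hβ := hb2le n hn4 k
      have hβ0 : 0 ≤ b n k := sqrt_nonneg _
      have hβ1 : b n k ≤ 1 := by nlinarith
      have hβ3 : θ * b n k ^ 2 ≤ 1 := (mul_le_mul_of_nonneg_left hβ hθ.le).trans hn3
      have hβs : b n k ≤ √(l / n) := le_sqrt_of_sq_le hβ
      have hd0 : 0 < d n k := lt_of_lt_of_le one_pos (hd1 n k)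
      have hd0' : 0 < d n (k + 1) := lt_of_lt_of_le one_pos (hd1 n (k + 1))
      have hdd : d n (k + 1) = d n k * (1 + θ * b n k ^ 2) := by
        rw [hb2, mul_add, mul_one]
        have : d n k * (θ * (l / (n * d n k))) = θ * l / n := by field_simp
        rw [this]
        simp only [hd]
        push_cast
        ring
      have hbb : b n (k + 1) ^ 2 * (1 + θ * b n k ^ 2) = b n k ^ 2 := by
        have h3 : (1 + θ * b n k ^ 2) = d n (k + 1) / d n k := by rw [hdd]; field_simp
        rw [h3, hb2, hb2]
        field_simp
      refine (abs_integral_step_succ_sub_le hα hθ (hd1 n k) he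
        (hone (b n k) hβ0 hβ1 hβ3) hbb hdd m z).trans ?_
      have hx : ∀ x y : ℕ, |b n k * x - b n k * y| = b n k * |(x : ℝ) - y| := fun x y => by
        rw [← mul_sub, abs_mul, abs_of_nonneg hβ0]
      have g1 := h₁ m (fun x => exp (-(b n k * x) ^ 2)) (4 * b n k) (by positivity)
        (fun x => exp_neg_sq_le_one _) fun x y =>
          (abs_exp_neg_sq_sub_le _ _).trans (le_of_eq (by rw [hx]; ring))
      have g2 := h₂ m (fun x => (b n k * x) ^ 2 * exp (-(b n k * x) ^ 2)) (12 * b n k)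
        (by positivity) (fun x => sq_mul_exp_neg_sq_le_one _) fun x y =>
          (abs_sq_mul_exp_neg_sq_sub_le _ _).trans (le_of_eq (by rw [hx]; ring))
      have g3 := heint m
      have g4 : A₁ * (4 * b n k) + A₂ * (12 * b n k) + K * b n k
          ≤ (4 * A₁ + 12 * A₂ + K) * √(l / n) := by
        have := mul_le_mul_of_nonneg_left hβs (show 0 ≤ 4 * A₁ + 12 * A₂ + K by positivity)
        linarith
      have g5 : 0 ≤ ∫ w, e w.1 ∂(X.step m z) := integral_nonneg fun w => (he _).1
      refine mul_le_mul hβ ?_ (by positivity) (by positivity)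
      linarith
    have htel : a n n - a n 0 = ∑ m ∈ Finset.range n, (a n (m + 1) - a n m) :=
      (Finset.sum_range_sub (a n) n).symm
    rw [htel]
    refine (Finset.abs_sum_le_sum_abs _ _).trans ((Finset.sum_le_sum hincr).trans (le_of_eq ?_))
    rw [← Finset.mul_sum]
    simp only [Finset.sum_add_distrib, Finset.sum_const, Finset.card_range, nsmul_eq_mul,
      ← Finset.mul_sum, hR]
    field_simp
  have hzero : Tendsto (fun n => a n 0) atTop (𝓝 ((1 + θ * l) ^ (-α))) := by
    have h1 : Tendsto (fun n : ℕ => (1 + θ * l) ^ (-α) *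
        exp (-(l / (1 + θ * l) * (z.1 : ℝ) ^ 2 / n))) atTop (𝓝 ((1 + θ * l) ^ (-α) * exp (-0))) :=
      ((continuous_exp.tendsto _).comp
        (tendsto_const_div_atTop_nhds_zero_nat _).neg).const_mul _
    rw [neg_zero, exp_zero, mul_one] at h1
    refine h1.congr' ?_
    filter_upwards [eventually_gt_atTop 0] with n hn
    have hn' : (n : ℝ) ≠ 0 := by exact_mod_cast hn.ne'
    have e1 : d n n = 1 + θ * l := by simp only [hd]; field_simp
    simp only [ha, X.step_zero, integral_dirac, Nat.sub_zero]
    rw [mul_pow, hb2, e1]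
    congr 3
    field_simp
  have := hmain.add hzero
  simp only [sub_add_cancel, zero_add] at this
  refine this.congr' (Eventually.of_forall fun n => ?_)
  simp only [ha, Nat.sub_self]
  have e1 : d n 0 = 1 := by simp [hd]
  simp only [hb, e1]
  simp

end Laplace

section JointLaplace

open Real

variable {S : Type*} [Fintype S] [MeasurableSpace S] [MeasurableSingletonClass S]

/-- A Laplace transform vanishing at infinity forces escape from every initial strip. -/
lemma tendsto_real_lt_zero_of_laplace {X : MChain (ℕ × S)} {α θ : ℝ} (hα : 0 < α) (hθ : 0 < θ)
    {z : ℕ × S} (hlap : ∀ l : ℝ, 0 < l →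
      Tendsto (fun n : ℕ => ∫ w, exp (-(√(l / n) * w.1) ^ 2) ∂(X.step n z)) atTop
      (𝓝 ((1 + θ * l) ^ (-α)))) (K : ℕ) :
    Tendsto (fun n => (X.step n z).real {w | w.1 < K}) atTop (𝓝 0) := by
  have hbound : ∀ l : ℝ, 0 < l → ∀ n : ℕ, (X.step n z).real {w | w.1 < K}
      ≤ exp (l * (K : ℝ) ^ 2 / n) * ∫ w, exp (-(√(l / n) * w.1) ^ 2) ∂(X.step n z) := by
    intro l hl n
    rw [← integral_const_mul, ← integral_indicator_one MeasurableSet.of_discrete]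
    refine integral_mono ((integrable_const (1 : ℝ)).indicator MeasurableSet.of_discrete)
      ((integrable_of_abs_le _ (M := 1) fun w => exp_neg_sq_le_one _).const_mul _) fun w => ?_
    by_cases hw : w.1 < K
    · rw [Set.indicator_of_mem (show w ∈ {w : ℕ × S | w.1 < K} from hw), Pi.one_apply, ← exp_add,
        one_le_exp_iff, mul_pow, sq_sqrt (by positivity)]
      have h1 : (w.1 : ℝ) ^ 2 ≤ (K : ℝ) ^ 2 := by
        have : (w.1 : ℝ) ≤ K := by exact_mod_cast hw.le
        gcongr
      have h2 := mul_le_mul_of_nonneg_left h1 (show 0 ≤ l / (n : ℝ) by positivity)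
      rw [mul_div_right_comm]
      linarith
    · rw [Set.indicator_of_notMem (show w ∉ {w : ℕ × S | w.1 < K} from hw)]
      positivity
  rw [Metric.tendsto_atTop]
  intro ε hε
  have hlim : Tendsto (fun l : ℝ => (1 + θ * l) ^ (-α)) atTop (𝓝 0) :=
    (tendsto_rpow_neg_atTop hα).comp
      (tendsto_atTop_add_const_left _ _ (tendsto_id.const_mul_atTop hθ))
  obtain ⟨l, hl, hl0⟩ := ((hlim.eventually (gt_mem_nhds hε)).and (eventually_gt_atTop 0)).exists
  have h1 : Tendsto (fun n : ℕ => exp (l * (K : ℝ) ^ 2 / n)) atTop (𝓝 1) := by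
    have := (continuous_exp.tendsto 0).comp
      (tendsto_const_div_atTop_nhds_zero_nat (l * (K : ℝ) ^ 2))
    rwa [exp_zero] at this
  have h2 := h1.mul (hlap l hl0)
  rw [one_mul] at h2
  obtain ⟨n₀, hn₀⟩ := eventually_atTop.1 (h2.eventually (gt_mem_nhds hl))
  refine ⟨n₀, fun n hn => ?_⟩
  rw [Real.dist_eq, sub_zero, abs_of_nonneg measureReal_nonneg]
  exact (hbound l hl0 n).trans_lt (hn₀ n hn)

lemma FourthMomentBound.tendsto_joint_laplace [DecidableEq S] [Nonempty S] {X : MChain (ℕ × S)}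
    {C D : ℝ} (h : FourthMomentBound X C) (hC : 0 ≤ C) (hD : LinearSecondMoment X D)
    {Q : S → S → ℝ} {pst : S → ℝ} (hQ : CondQ X Q) (hpst : IsStationaryDist Q pst)
    (hap : IsAperiodicMatrix Q) {α θ : ℝ} (hα : 0 < α) (hθ : 0 < θ)
    {z : ℕ × S} (hlap : ∀ l : ℝ, 0 < l →
      Tendsto (fun n : ℕ => ∫ w, exp (-(√(l / n) * w.1) ^ 2) ∂(X.step n z)) atTop
      (𝓝 ((1 + θ * l) ^ (-α)))) {l : ℝ} (hl : 0 ≤ l) (k : S) :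
    Tendsto (fun n : ℕ => ∫ w, exp (-(√(l / n) * w.1) ^ 2) * (if w.2 = k then 1 else 0)
      ∂(X.step n z)) atTop (𝓝 (pst k * (1 + θ * l) ^ (-α))) := by
  have hlap' : Tendsto (fun n : ℕ => ∫ w, exp (-(√(l / n) * w.1) ^ 2) ∂(X.step n z)) atTop
      (𝓝 ((1 + θ * l) ^ (-α))) := by
    rcases hl.eq_or_lt with rfl | hl0
    · simp
    · exact hlap l hl0
  set ψ : S → ℝ := fun i => (if i = k then 1 else 0) - pst k with hψ
  have hψ0 : ∑ i, pst i * ψ i = 0 := by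
    simp [hψ, mul_sub, Finset.sum_sub_distrib, ← Finset.sum_mul, hpst.2.1]
  have hψi : ∀ n : ℕ, Integrable (fun w : ℕ × S => exp (-(√(l / n) * w.1) ^ 2)) (X.step n z) :=
    fun n => integrable_of_abs_le _ (M := 1) fun w => exp_neg_sq_le_one _
  have hki : ∀ n : ℕ, Integrable (fun w : ℕ × S => exp (-(√(l / n) * w.1) ^ 2)
      * (if w.2 = k then 1 else 0)) (X.step n z) := fun n =>
    integrable_of_abs_le _ (M := 1) fun w => by
      rw [abs_mul]
      exact (mul_le_mul (exp_neg_sq_le_one _)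
        (show |(if w.2 = k then (1 : ℝ) else 0)| ≤ 1 by split_ifs <;> simp)
        (abs_nonneg _) zero_le_one).trans (by norm_num)
  have hmain : Tendsto (fun n : ℕ => ∫ w, exp (-(√(l / n) * w.1) ^ 2) * ψ w.2 ∂(X.step n z))
      atTop (𝓝 0) := by
    rw [Metric.tendsto_atTop]
    intro ε hε
    obtain ⟨N, K, A, hA, hdec⟩ := h.exists_decoupling hC hD hQ hpst hap hψ0 (half_pos hε)
    have t1 := (tendsto_real_lt_zero_of_laplace hα hθ hlap K).comp (tendsto_sub_atTop_nat N)
    have t2 : Tendsto (fun n : ℕ => √(l / (n : ℝ))) atTop (𝓝 0) := by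
      have := (continuous_sqrt.tendsto 0).comp (tendsto_const_div_atTop_nhds_zero_nat l)
      rwa [sqrt_zero] at this
    have t3 : Tendsto (fun n : ℕ => 1 * (ε / 2 + A * (X.step (n - N) z).real {w | w.1 < K})
        + A * (4 * √(l / n))) atTop (𝓝 (1 * (ε / 2 + A * 0) + A * (4 * 0))) :=
      (((t1.const_mul A).const_add _).const_mul 1).add ((t2.const_mul 4).const_mul A)
    obtain ⟨n₀, hn₀⟩ := eventually_atTop.1 (t3.eventually
      (gt_mem_nhds (show 1 * (ε / 2 + A * 0) + A * (4 * 0) < ε by linarith)))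
    refine ⟨max n₀ N, fun n hn => ?_⟩
    rw [Real.dist_eq, sub_zero]
    refine lt_of_le_of_lt ?_ (hn₀ n ((le_max_left _ _).trans hn))
    have := hdec (n - N) z (fun x => exp (-(√(l / n) * x) ^ 2)) 1 (4 * √(l / n)) (by positivity)
      (fun x => exp_neg_sq_le_one _) fun x y => (abs_exp_neg_sq_sub_le _ _).trans (le_of_eq (by
        rw [← mul_sub, abs_mul, abs_of_nonneg (sqrt_nonneg _)]; ring))
    rwa [Nat.sub_add_cancel ((le_max_right _ _).trans hn)] at this
  have h2 := hmain.add (hlap'.const_mul (pst k))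
  rw [zero_add] at h2
  refine h2.congr fun n => ?_
  have e : ∫ w, exp (-(√(l / n) * w.1) ^ 2) * ψ w.2 ∂(X.step n z)
      = ∫ w, exp (-(√(l / n) * w.1) ^ 2) * (if w.2 = k then 1 else 0) ∂(X.step n z)
        - pst k * ∫ w, exp (-(√(l / n) * w.1) ^ 2) ∂(X.step n z) := by
    rw [← integral_const_mul, ← integral_sub (hki n) ((hψi n).const_mul _)]
    exact integral_congr_ae (ae_of_all _ fun w => by simp only [hψ]; ring)
  rw [e]
  ring

end JointLaplace

section RootGamma

open Real

/-- The density of the square root of a Gamma random variable. -/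
noncomputable def rootGammaDensity (α θ : ℝ) : ℝ → ℝ :=
  Set.indicator (Set.Ioi 0) fun u =>
    2 * u ^ (2 * α - 1) * exp (-(u ^ 2) / θ) / (θ ^ α * Gamma α)

variable {α θ : ℝ}

lemma rootGammaDensity_nonneg (hα : 0 < α) (hθ : 0 < θ) (u : ℝ) : 0 ≤ rootGammaDensity α θ u := by
  refine Set.indicator_nonneg (fun u hu => ?_) u
  have := Gamma_pos_of_pos hα
  have : 0 ≤ u ^ (2 * α - 1) := rpow_nonneg (le_of_lt hu) _
  positivity

lemma integral_rootGammaDensity_mul_exp (hα : 0 < α) (hθ : 0 < θ) (j : ℕ) :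
    ∫ u, rootGammaDensity α θ u * exp (-u ^ 2) ^ j = (1 + θ * j) ^ (-α) := by
  have hΓ := Gamma_pos_of_pos hα
  have e : ∀ u, rootGammaDensity α θ u * exp (-u ^ 2) ^ j = Set.indicator (Set.Ioi 0) (fun u =>
      2 / (θ ^ α * Gamma α) * (u ^ (2 * α - 1) * exp (-(1 / θ + j) * u ^ (2 : ℝ)))) u := by
    intro u
    by_cases hu : u ∈ Set.Ioi (0 : ℝ)
    · rw [rootGammaDensity, Set.indicator_of_mem hu, Set.indicator_of_mem hu, ← exp_nat_mul,
        rpow_two]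
      have : exp (-(1 / θ + j) * u ^ 2) = exp (-(u ^ 2) / θ) * exp (j * -u ^ 2) := by
        rw [← exp_add]; congr 1; ring
      rw [this]
      ring
    · rw [rootGammaDensity, Set.indicator_of_notMem hu, Set.indicator_of_notMem hu, zero_mul]
  simp_rw [e]
  have hb : 0 < 1 / θ + j := by positivity
  rw [integral_indicator measurableSet_Ioi, integral_const_mul,
    integral_rpow_mul_exp_neg_mul_rpow (by norm_num) (by linarith) hb]
  have h1 : (2 * α - 1 + 1) / 2 = α := by ring
  have h2 : -(2 * α - 1 + 1) / 2 = -α := by ring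
  have h3 : 1 / θ + j = (1 + θ * j) / θ := by field_simp
  rw [h1, h2, h3, div_rpow (by positivity) hθ.le, rpow_neg hθ.le]
  field_simp

lemma integrable_rootGammaDensity (hα : 0 < α) (hθ : 0 < θ) :
    Integrable (rootGammaDensity α θ) := by
  refine Integrable.of_integral_ne_zero ?_
  have := integral_rootGammaDensity_mul_exp hα hθ 0
  simp only [pow_zero, mul_one, Nat.cast_zero, mul_zero, add_zero, one_rpow] at this
  rw [this]
  exact one_ne_zero

lemma Fdist_eq_integral_rootGammaDensity {x : ℝ} (hx : 0 ≤ x) :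
    Fdist α θ x = ∫ u in (0 : ℝ)..x, rootGammaDensity α θ u := by
  rw [Fdist, intervalIntegral.integral_of_le hx, intervalIntegral.integral_of_le hx]
  refine setIntegral_congr_fun measurableSet_Ioc fun u hu => ?_
  rw [rootGammaDensity, Set.indicator_of_mem (show u ∈ Set.Ioi 0 from hu.1)]

lemma continuous_integral_rootGammaDensity (hα : 0 < α) (hθ : 0 < θ) :
    Continuous fun x => ∫ u in (0 : ℝ)..x, rootGammaDensity α θ u :=
  intervalIntegral.continuous_primitive
    (fun _ _ => (integrable_rootGammaDensity hα hθ).intervalIntegrable) 0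

end RootGamma

section Moments

open Polynomial

/-- Convergence of moments of `[0, 1]`-valued variables, weighted by a bounded function, upgrades
to convergence against continuous test functions. -/
lemma tendsto_integral_comp_of_tendsto_moments {E : Type*} [MeasurableSpace E]
    [DiscreteMeasurableSpace E] [Countable E] {μ : ℕ → Measure E} [∀ n, IsProbabilityMeasure (μ n)]
    {Y : ℕ → E → ℝ} (hY : ∀ n w, Y n w ∈ Set.Icc (0 : ℝ) 1) {g : E → ℝ} (hg : ∀ w, |g w| ≤ 1)
    {ρ : ℝ → ℝ} (hρ0 : ∀ u, 0 ≤ ρ u) (hρ : Integrable ρ) {V : ℝ → ℝ} (hVc : Continuous V)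
    (hV : ∀ u, V u ∈ Set.Icc (0 : ℝ) 1) {a : ℝ} (ha : 0 ≤ a)
    (hmom : ∀ j : ℕ, Tendsto (fun n => ∫ w, Y n w ^ j * g w ∂(μ n)) atTop
      (𝓝 (a * ∫ u, ρ u * V u ^ j))) {f : ℝ → ℝ} (hf : Continuous f) :
    Tendsto (fun n => ∫ w, f (Y n w) * g w ∂(μ n)) atTop (𝓝 (a * ∫ u, ρ u * f (V u))) := by
  have hbdd : ∀ φ : ℝ → ℝ, Continuous φ → ∃ M, 0 ≤ M ∧ ∀ y ∈ Set.Icc (0 : ℝ) 1, |φ y| ≤ M := by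
    intro φ hφ
    obtain ⟨M, hM⟩ := isCompact_Icc.exists_bound_of_continuousOn (hφ.continuousOn (s := Set.Icc 0 1))
    exact ⟨M, (norm_nonneg _).trans (hM 0 (by simp)), hM⟩
  have hi1 : ∀ φ : ℝ → ℝ, Continuous φ → ∀ n, Integrable (fun w => φ (Y n w) * g w) (μ n) := by
    intro φ hφ n
    obtain ⟨M, hM0, hM⟩ := hbdd φ hφ
    refine integrable_of_abs_le _ (M := M) fun w => ?_
    rw [abs_mul]
    exact (mul_le_mul (hM _ (hY n w)) (hg w) (abs_nonneg _) hM0).trans (mul_one M).le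
  have hi2 : ∀ φ : ℝ → ℝ, Continuous φ → Integrable (fun u => ρ u * φ (V u)) := by
    intro φ hφ
    obtain ⟨M, hM0, hM⟩ := hbdd φ hφ
    exact hρ.mul_bdd (c := M) (hφ.comp hVc).aestronglyMeasurable (ae_of_all _ fun u => hM _ (hV u))
  have hpoly : ∀ P : ℝ[X], Tendsto (fun n => ∫ w, P.eval (Y n w) * g w ∂(μ n)) atTop
      (𝓝 (a * ∫ u, ρ u * P.eval (V u))) := by
    intro P
    have e1 : ∀ n, ∫ w, P.eval (Y n w) * g w ∂(μ n)
        = ∑ j ∈ Finset.range (P.natDegree + 1), P.coeff j * ∫ w, Y n w ^ j * g w ∂(μ n) := by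
      intro n
      simp_rw [← integral_const_mul]
      rw [← integral_finsetSum _ fun j _ => (hi1 _ (continuous_pow j) n).const_mul _]
      refine integral_congr_ae (ae_of_all _ fun w => ?_)
      simp only [eval_eq_sum_range, Finset.sum_mul, mul_assoc]
    have e2 : a * ∫ u, ρ u * P.eval (V u)
        = ∑ j ∈ Finset.range (P.natDegree + 1), P.coeff j * (a * ∫ u, ρ u * V u ^ j) := by
      have : ∫ u, ρ u * P.eval (V u) = ∑ j ∈ Finset.range (P.natDegree + 1),
          P.coeff j * ∫ u, ρ u * V u ^ j := by
        simp_rw [← integral_const_mul]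
        rw [← integral_finsetSum _ fun j _ => (hi2 _ (continuous_pow j)).const_mul _]
        refine integral_congr_ae (ae_of_all _ fun u => ?_)
        simp only [eval_eq_sum_range, Finset.mul_sum]
        exact Finset.sum_congr rfl fun j _ => by ring
      rw [this, Finset.mul_sum]
      exact Finset.sum_congr rfl fun j _ => by ring
    simp_rw [e1]
    rw [e2]
    exact tendsto_finsetSum _ fun j _ => (hmom j).const_mul _
  rw [Metric.tendsto_atTop]
  intro ε hε
  have hI : 0 ≤ ∫ u, ρ u := integral_nonneg hρ0
  set δ := ε / (3 + a * ∫ u, ρ u) with hδ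
  have hden : 0 < 3 + a * ∫ u, ρ u := by positivity
  have hδ0 : 0 < δ := by positivity
  have hδε : δ + δ + a * ∫ u, ρ u * δ < ε := by
    rw [integral_mul_const]
    have : δ * (3 + a * ∫ u, ρ u) = ε := div_mul_cancel₀ _ hden.ne'
    nlinarith
  obtain ⟨P, hP⟩ := exists_polynomial_near_of_continuousOn 0 1 f hf.continuousOn δ hδ0
  obtain ⟨n₀, hn₀⟩ := Metric.tendsto_atTop.1 (hpoly P) δ hδ0
  refine ⟨n₀, fun n hn => ?_⟩
  have h1 := hn₀ n hn
  have h2 : |(∫ w, P.eval (Y n w) * g w ∂(μ n)) - ∫ w, f (Y n w) * g w ∂(μ n)| ≤ δ := by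
    rw [← integral_sub (hi1 _ P.continuous n) (hi1 f hf n)]
    refine abs_integral_le_of_abs_le _ fun w => ?_
    rw [← sub_mul, abs_mul]
    exact (mul_le_mul (hP _ (hY n w)).le (hg w) (abs_nonneg _) hδ0.le).trans (mul_one δ).le
  have h3 : |(∫ u, ρ u * P.eval (V u)) - ∫ u, ρ u * f (V u)| ≤ ∫ u, ρ u * δ := by
    rw [← integral_sub (hi2 _ P.continuous) (hi2 f hf)]
    refine (abs_integral_le_integral_abs).trans (integral_mono
      ((hi2 _ P.continuous).sub (hi2 f hf)).abs (hρ.mul_const δ) fun u => ?_)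
    rw [← mul_sub, abs_mul, abs_of_nonneg (hρ0 u)]
    exact mul_le_mul_of_nonneg_left (hP _ (hV u)).le (hρ0 u)
  rw [Real.dist_eq] at h1 ⊢
  have h4 := mul_le_mul_of_nonneg_left h3 ha
  rw [← abs_of_nonneg ha, ← abs_mul, abs_of_nonneg ha, mul_sub] at h4
  rw [abs_lt] at *
  rw [abs_le] at *
  constructor <;> linarith [h1.1, h1.2, h2.1, h2.2, h4.1, h4.2]

end Moments

section Limit

open Real

/-- A continuous ramp separating the points `exp (-b ^ 2)` and `exp (-a ^ 2)`. -/
lemma exists_continuous_ramp {a b : ℝ} (ha : 0 ≤ a) (hab : a < b) :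
    ∃ f : ℝ → ℝ, Continuous f ∧ (∀ y, 0 ≤ f y) ∧ (∀ y, f y ≤ 1) ∧
      (∀ u, 0 ≤ u → u ≤ a → f (exp (-u ^ 2)) = 1) ∧
      (∀ u, 0 ≤ u → b < u → f (exp (-u ^ 2)) = 0) := by
  have hlt : exp (-b ^ 2) < exp (-a ^ 2) := exp_lt_exp.2 (by nlinarith)
  have hd : 0 < exp (-a ^ 2) - exp (-b ^ 2) := sub_pos.2 hlt
  refine ⟨fun y => max 0 (min 1 ((y - exp (-b ^ 2)) / (exp (-a ^ 2) - exp (-b ^ 2)))),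
    by fun_prop, fun y => le_max_left _ _, fun y => max_le zero_le_one (min_le_left _ _),
    fun u hu hua => ?_, fun u hu hbu => ?_⟩
  · have : exp (-a ^ 2) ≤ exp (-u ^ 2) := exp_le_exp.2 (by nlinarith)
    have : 1 ≤ (exp (-u ^ 2) - exp (-b ^ 2)) / (exp (-a ^ 2) - exp (-b ^ 2)) :=
      (one_le_div hd).2 (by linarith)
    simp only [min_eq_left this, max_eq_right zero_le_one]
  · have : exp (-u ^ 2) ≤ exp (-b ^ 2) := exp_le_exp.2 (by nlinarith)
    have : (exp (-u ^ 2) - exp (-b ^ 2)) / (exp (-a ^ 2) - exp (-b ^ 2)) ≤ 0 :=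
      div_nonpos_of_nonpos_of_nonneg (by linarith) hd.le
    exact max_eq_left ((min_le_right _ _).trans this)

variable {S : Type*} [Fintype S] [MeasurableSpace S] [MeasurableSingletonClass S]

/-- Joint convergence of Laplace transforms to that of a root-Gamma law gives convergence of
distribution functions. -/
lemma tendsto_real_le_of_joint_laplace [DecidableEq S] {X : MChain (ℕ × S)} {α θ : ℝ} (hα : 0 < α)
    (hθ : 0 < θ) {z : ℕ × S} {k : S} {a : ℝ} (ha : 0 ≤ a)
    (hlap : ∀ l : ℝ, 0 ≤ l → Tendsto (fun n : ℕ => ∫ w, exp (-(√(l / n) * w.1) ^ 2)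
      * (if w.2 = k then 1 else 0) ∂(X.step n z)) atTop (𝓝 (a * (1 + θ * l) ^ (-α))))
    {x : ℝ} (hx : 0 ≤ x) :
    Tendsto (fun n : ℕ => (X.step n z).real {w | (w.1 : ℝ) ≤ √n * x ∧ w.2 = k}) atTop
      (𝓝 (a * Fdist α θ x)) := by
  set F : ℝ → ℝ := fun x => ∫ u in (0 : ℝ)..x, rootGammaDensity α θ u with hF
  have hFc : Continuous F := continuous_integral_rootGammaDensity hα hθ
  rw [Fdist_eq_integral_rootGammaDensity hx]
  change Tendsto _ _ (𝓝 (a * F x))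
  have hρ := integrable_rootGammaDensity hα hθ
  have hρ0 := rootGammaDensity_nonneg hα hθ
  have hexp : ∀ t : ℝ, exp (-t ^ 2) ∈ Set.Icc (0 : ℝ) 1 := fun t =>
    ⟨(exp_pos _).le, exp_le_one_iff.2 (neg_nonpos.2 (sq_nonneg t))⟩
  have hg : ∀ w : ℕ × S, |(if w.2 = k then (1 : ℝ) else 0)| ≤ 1 := fun w => by
    split_ifs <;> simp
  have htest : ∀ f : ℝ → ℝ, Continuous f →
      Tendsto (fun n : ℕ => ∫ w, f (exp (-((w.1 : ℝ) / √n) ^ 2)) * (if w.2 = k then 1 else 0)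
        ∂(X.step n z)) atTop (𝓝 (a * ∫ u, rootGammaDensity α θ u * f (exp (-u ^ 2)))) := by
    intro f hf
    refine tendsto_integral_comp_of_tendsto_moments (μ := fun n => X.step n z)
      (Y := fun n w => exp (-((w.1 : ℝ) / √n) ^ 2)) (fun n w => hexp _)
      (g := fun w => if w.2 = k then 1 else 0) hg hρ0 hρ
      (V := fun u => exp (-u ^ 2)) (by fun_prop) hexp ha (fun j => ?_) hf
    rw [integral_rootGammaDensity_mul_exp hα hθ]
    refine (hlap j j.cast_nonneg).congr fun n => integral_congr_ae (ae_of_all _ fun w => ?_)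
    simp only
    rw [← exp_nat_mul, mul_pow, sq_sqrt (by positivity), div_pow, sq_sqrt (by positivity)]
    congr 2
    ring
  have hFind : ∀ b, 0 ≤ b → F b = ∫ u, Set.indicator (Set.Ioc 0 b) (rootGammaDensity α θ) u :=
    fun b hb => by
      rw [integral_indicator measurableSet_Ioc, hF]
      exact intervalIntegral.integral_of_le hb
  have hsand : ∀ b c : ℝ, 0 ≤ b → b < c → ∃ L : ℕ → ℝ, ∃ m : ℝ, Tendsto L atTop (𝓝 (a * m)) ∧
      F b ≤ m ∧ m ≤ F c ∧ ∀ n : ℕ, 0 < n →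
        (X.step n z).real {w | (w.1 : ℝ) ≤ √n * b ∧ w.2 = k} ≤ L n ∧
        L n ≤ (X.step n z).real {w | (w.1 : ℝ) ≤ √n * c ∧ w.2 = k} := by
    intro b c hb hbc
    obtain ⟨f, hf, f0, f1, fb, fc⟩ := exists_continuous_ramp hb hbc
    have hi : Integrable fun u => rootGammaDensity α θ u * f (exp (-u ^ 2)) :=
      hρ.mul_bdd (c := 1) (by fun_prop) (ae_of_all _ fun u => by
        rw [norm_eq_abs, abs_of_nonneg (f0 _)]; exact f1 _)
    refine ⟨_, _, htest f hf, ?_, ?_, fun n hn => ?_⟩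
    · rw [hFind b hb]
      refine integral_mono (hρ.indicator measurableSet_Ioc) hi fun u => ?_
      by_cases hu : u ∈ Set.Ioc 0 b
      · simp only [Set.indicator_of_mem hu, fb u hu.1.le hu.2, mul_one, le_refl]
      · simp only [Set.indicator_of_notMem hu]
        exact mul_nonneg (hρ0 u) (f0 _)
    · rw [hFind c (hb.trans hbc.le)]
      refine integral_mono hi (hρ.indicator measurableSet_Ioc) fun u => ?_
      by_cases hu : u ∈ Set.Ioc 0 c
      · simp only [Set.indicator_of_mem hu]
        exact mul_le_of_le_one_right (hρ0 u) (f1 _)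
      · simp only [Set.indicator_of_notMem hu]
        rcases le_or_gt u 0 with h0 | h0
        · rw [rootGammaDensity, Set.indicator_of_notMem (show u ∉ Set.Ioi 0 from not_lt.2 h0), zero_mul]
        · rw [fc u h0.le (not_le.1 fun h => hu ⟨h0, h⟩), mul_zero]
    · have hn' : 0 < √(n : ℝ) := sqrt_pos.2 (by exact_mod_cast hn)
      have hiL : Integrable (fun w : ℕ × S => f (exp (-((w.1 : ℝ) / √n) ^ 2))
          * (if w.2 = k then 1 else 0)) (X.step n z) :=
        integrable_of_abs_le _ (M := 1) fun w => by
          rw [abs_mul, abs_of_nonneg (f0 _)]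
          exact (mul_le_mul (f1 _) (hg w) (abs_nonneg _) zero_le_one).trans (by norm_num)
      have hL0 : ∀ w : ℕ × S, 0 ≤ f (exp (-((w.1 : ℝ) / √n) ^ 2))
          * (if w.2 = k then 1 else 0) := fun w =>
        mul_nonneg (f0 _) (by split_ifs <;> simp)
      constructor
      · rw [← integral_indicator_one MeasurableSet.of_discrete]
        refine integral_mono ((integrable_const (1 : ℝ)).indicator MeasurableSet.of_discrete) hiL
          fun w => ?_
        by_cases hw : (w.1 : ℝ) ≤ √n * b ∧ w.2 = k
        · rw [Set.indicator_of_mem (by exact hw), Pi.one_apply]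
          simp only [hw.2, if_true, mul_one]
          rw [fb _ (by positivity) ((div_le_iff₀' hn').2 hw.1)]
        · rw [Set.indicator_of_notMem (by exact hw)]
          exact hL0 w
      · rw [← integral_indicator_one MeasurableSet.of_discrete]
        refine integral_mono hiL
          ((integrable_const (1 : ℝ)).indicator MeasurableSet.of_discrete) fun w => ?_
        by_cases hw : (w.1 : ℝ) ≤ √n * c ∧ w.2 = k
        · rw [Set.indicator_of_mem (by exact hw), Pi.one_apply]
          simp only [hw.2, if_true, mul_one]
          exact f1 _
        · rw [Set.indicator_of_notMem (by exact hw)]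
          by_cases hk : w.2 = k
          · have : c < (w.1 : ℝ) / √n := (lt_div_iff₀' hn').2 (not_le.1 fun h => hw ⟨h, hk⟩)
            simp only [fc _ (by positivity) this, zero_mul, le_refl]
          · simp only [hk, if_false, mul_zero, le_refl]
  refine tendsto_order.2 ⟨fun y hy => ?_, fun y hy => ?_⟩
  · rcases hx.eq_or_lt with rfl | hx0
    · have : F 0 = 0 := intervalIntegral.integral_same
      rw [this, mul_zero] at hy
      exact Eventually.of_forall fun n => hy.trans_le measureReal_nonneg
    · have h1 : Tendsto (fun b => a * F b) (𝓝[<] x) (𝓝 (a * F x)) :=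
        ((hFc.const_mul a).tendsto x).mono_left nhdsWithin_le_nhds
      obtain ⟨b, hb, hb0, hbx⟩ := ((h1.eventually (lt_mem_nhds hy)).and
        (Ioo_mem_nhdsLT hx0)).exists
      obtain ⟨L, m, hL, hm, -, hLn⟩ := hsand b x hb0.le hbx
      filter_upwards [hL.eventually (lt_mem_nhds (hb.trans_le (mul_le_mul_of_nonneg_left hm ha))),
        eventually_gt_atTop 0] with n h2 h3
      exact h2.trans_le (hLn n h3).2
  · have h1 : Tendsto (fun b => a * F b) (𝓝[>] x) (𝓝 (a * F x)) :=
      ((hFc.const_mul a).tendsto x).mono_left nhdsWithin_le_nhds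
    obtain ⟨b, hb, hbx⟩ := ((h1.eventually (gt_mem_nhds hy)).and self_mem_nhdsWithin).exists
    obtain ⟨L, m, hL, -, hm, hLn⟩ := hsand x b hx hbx
    filter_upwards [hL.eventually (gt_mem_nhds ((mul_le_mul_of_nonneg_left hm ha).trans_lt hb)),
      eventually_gt_atTop 0] with n h2 h3
    exact (hLn n h3).1.trans_lt h2

end Limit

variable {S : Type*} [Fintype S] [DecidableEq S] [Nonempty S]
  [MeasurableSpace S] [MeasurableSingletonClass S]

/-- Theorem 3 (weak convergence): under (B_p) for some `p > 4`, (Q_∞) with `q` aperiodic and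
(M_L), if `Σ_i (2c_i + s_i²) π(i) > 0` then `P[n^{-1/2} X_n ≤ x, η_n = k] → π(k) F_{α,θ}(x)`
with `α = 1/2 + (Σ c_i π(i))/(Σ s_i² π(i))` and `θ = 2 Σ s_i² π(i)`. -/
theorem stmt4 (X : MChain (ℕ × S)) (hirr : X.Irreducible)
    (p : ℝ) (hp : 4 < p) (hB : CondB X p)
    (Q : S → S → ℝ) (pst : S → ℝ) (hQ : CondQ X Q) (hpst : IsStationaryDist Q pst)
    (hap : IsAperiodicMatrix Q)
    (c s2 : S → ℝ) (hML : CondML X c s2)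
    (hpos : 0 < ∑ i, (2 * c i + s2 i) * pst i) :
    ∀ (z : ℕ × S) (k : S) (x : ℝ), 0 ≤ x →
      Tendsto (fun n : ℕ =>
          (X.P z {ω | ((ω n).1 : ℝ) ≤ Real.sqrt n * x ∧ (ω n).2 = k}).toReal)
        atTop
        (nhds (pst k *
          Fdist (1 / 2 + (∑ i, c i * pst i) / (∑ i, s2 i * pst i))
            (2 * ∑ i, s2 i * pst i) x)) := by
  intro z k x hx
  obtain ⟨C, hC, h⟩ := hB.exists_fourthMomentBound hp
  obtain ⟨D, hD0, hD⟩ := h.exists_linearSecondMoment hML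
  have hs : 0 < ∑ i, s2 i * pst i := by
    obtain ⟨i, hi⟩ := hML.2.1
    exact Finset.sum_pos' (fun j _ => mul_nonneg (hML.1 j) (hpst.1 j).le)
      ⟨i, Finset.mem_univ i, mul_pos ((hML.1 i).lt_of_ne' hi) (hpst.1 i)⟩
  have hθ : 0 < 2 * ∑ i, s2 i * pst i := by positivity
  have hαθ : ∑ i, (2 * c i + s2 i) * pst i
      = (1 / 2 + (∑ i, c i * pst i) / (∑ i, s2 i * pst i)) * (2 * ∑ i, s2 i * pst i) := by
    have : ∑ i, (2 * c i + s2 i) * pst i = 2 * ∑ i, c i * pst i + ∑ i, s2 i * pst i := by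
      rw [Finset.mul_sum, ← Finset.sum_add_distrib]
      exact Finset.sum_congr rfl fun i _ => by ring
    rw [this]
    field_simp
    ring
  have hα : 0 < 1 / 2 + (∑ i, c i * pst i) / (∑ i, s2 i * pst i) :=
    pos_of_mul_pos_left (hαθ ▸ hpos) hθ.le
  have hlap := fun l hl => h.tendsto_laplace hC hirr hD0 hD hQ hpst hap hML hα hθ hαθ rfl z
    (l := l) hl
  have hjoint := fun l hl => h.tendsto_joint_laplace hC hD hQ hpst hap hα hθ hlap (l := l) hl k
  refine (tendsto_real_le_of_joint_laplace hα hθ (hpst.1 k).le hjoint hx).congr fun n => ?_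
  rw [measureReal_def, X.step_apply]
  rfl
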